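/- Let H be a semisimple Hopf algebra over an algebraically closed field of characteristic zero. If H has a nontrivial self-dual simple module, then the dimension of H is even. -/

import Mathlib

open HopfAlgebra Module

/-- The trivial one-dimensional `H`-module: `H` acts on the base field `K`
through the counit `ε`, i.e. `h • c = ε(h) * c`. -/
noncomputable local instance trivialHModule {K H : Type*} [CommSemiring K] [Semiring H]
    [Bialgebra K H] : Module H K :=
  Module.compHom K (Bialgebra.counitAlgHom K H).toRingHom


namespace SD
set_option linter.all false
set_option linter.unusedSectionVars false
set_option linter.unusedSimpArgs false
open TensorProduct Coalgebra HopfAlgebra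

section toolkit
variable {K : Type*} [Field K]
variable {A B C M N : Type*} [AddCommGroup A] [Module K A] [AddCommGroup B] [Module K B]
  [AddCommGroup C] [Module K C]
  [AddCommGroup M] [Module K M] [AddCommGroup N] [Module K N]

/-- Bilinearity of a function of two variables, as a predicate. -/
structure Bil (K : Type*) [Field K] {A B M : Type*} [AddCommGroup A] [Module K A]
    [AddCommGroup B] [Module K B] [AddCommGroup M] [Module K M] (F : A → B → M) : Prop where
  al : ∀ a a' b, F (a + a') b = F a b + F a' b
  ar : ∀ a b b', F a (b + b') = F a b + F a b'
  sl : ∀ (c : K) a b, F (c • a) b = c • F a b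
  sr : ∀ (c : K) a b, F a (c • b) = c • F a b

/-- Linearity of a function, as a predicate. -/
structure Lin (K : Type*) [Field K] {A M : Type*} [AddCommGroup A] [Module K A]
    [AddCommGroup M] [Module K M] (f : A → M) : Prop where intro ::
  a : ∀ x y, f (x + y) = f x + f y
  s : ∀ (c : K) x, f (c • x) = c • f x

/-- Bundled version. -/
def Lin.mk {f : A → M} (hf : Lin K f) : A →ₗ[K] M where
  toFun := f
  map_add' := hf.a
  map_smul' := hf.s

@[simp] lemma Lin.mk_apply {f : A → M} (hf : Lin K f) (x : A) : hf.mk x = f x := rfl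

/-- The linear map out of a tensor product attached to a bilinear function. -/
noncomputable def tl (F : A → B → M) (hF : Bil K F) : A ⊗[K] B →ₗ[K] M :=
  TensorProduct.lift (LinearMap.mk₂ K F hF.al hF.sl hF.ar hF.sr)

@[simp] lemma tl_tmul (F : A → B → M) (hF : Bil K F) (a : A) (b : B) :
    tl F hF (a ⊗ₜ b) = F a b := rfl

variable [FiniteDimensional K B]

/-- Components of a tensor with respect to the standard basis of the right factor. -/
noncomputable def comp (i : Fin (Module.finrank K B)) : A ⊗[K] B →ₗ[K] A :=
  (TensorProduct.rid K A).toLinearMap ∘ₗ LinearMap.lTensor A ((Module.finBasis K B).coord i)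

/-- Sweedler type sum: `tsum t F = ∑ F t₁ t₂`. -/
noncomputable def tsum (t : A ⊗[K] B) (F : A → B → M) : M :=
  ∑ i, F (comp i t) (Module.finBasis K B i)

lemma tsum_tmul (F : A → B → M) (hF : Bil K F) (a : A) (b : B) :
    tsum (a ⊗ₜ[K] b) F = F a b := by
  have h : ∀ i, F (comp i (a ⊗ₜ[K] b)) (Module.finBasis K B i) =
      (LinearMap.mk₂ K F hF.al hF.sl hF.ar hF.sr a)
        ((Module.finBasis K B).repr b i • Module.finBasis K B i) := by
    intro i
    simp [comp, hF.sl, hF.sr]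
  unfold tsum
  simp_rw [h]
  rw [← map_sum, (Module.finBasis K B).sum_repr b]
  rfl

lemma tsum_eq (F : A → B → M) (hF : Bil K F) (t : A ⊗[K] B) : tsum t F = tl F hF t := by
  have hz : tsum (0 : A ⊗[K] B) F = 0 := by
    have := tsum_tmul F hF 0 0
    rw [TensorProduct.zero_tmul] at this
    rw [this]; simpa using hF.sl 0 0 0
  induction t with
  | zero => rw [hz, map_zero]
  | tmul a b => rw [tsum_tmul F hF]; rfl
  | add x y hx hy =>
    rw [map_add, ← hx, ← hy]
    simp [tsum, hF.al, Finset.sum_add_distrib]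

lemma map_tsum (φ : M →ₗ[K] N) (t : A ⊗[K] B) (F : A → B → M) :
    φ (tsum t F) = tsum t (fun a b => φ (F a b)) := by simp [tsum]

lemma tsum_congr (t : A ⊗[K] B) {F G : A → B → M} (h : ∀ a b, F a b = G a b) :
    tsum t F = tsum t G := by simp [tsum, h]

lemma tsum_comm {A' B' : Type*} [AddCommGroup A'] [Module K A'] [AddCommGroup B'] [Module K B']
    [FiniteDimensional K B'] (t : A ⊗[K] B) (t' : A' ⊗[K] B') (F : A → B → A' → B' → M) :
    tsum t (fun a b => tsum t' (fun c d => F a b c d)) =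
      tsum t' (fun c d => tsum t (fun a b => F a b c d)) := by
  simp only [tsum]; exact Finset.sum_comm

lemma tsum_self (t : A ⊗[K] B) : tsum t (fun a b => a ⊗ₜ[K] b) = t := by
  rw [tsum_eq _ ⟨by simp [add_tmul], by simp [tmul_add], by simp [smul_tmul'], by simp⟩]
  conv_rhs => rw [← LinearMap.id_apply (R := K) t]
  congr 1
  ext; simp

lemma tsum_of_eq {t : A ⊗[K] B} {t' : A ⊗[K] B} (F : A → B → M) (h : t = t') :
    tsum t F = tsum t' F := by rw [h]

lemma tsum_smul (c : K) (t : A ⊗[K] B) (F : A → B → M) :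
    tsum t (fun a b => c • F a b) = c • tsum t F := by simp [tsum, Finset.smul_sum]

end toolkit

section hopf
variable {K : Type*} [Field K]
variable {H : Type*} [Ring H] [HopfAlgebra K H] [FiniteDimensional K H]
variable {M N W : Type*} [AddCommGroup M] [Module K M] [AddCommGroup N] [Module K N]
  [AddCommGroup W] [Module K W]

variable (K) in
/-- Sweedler sum over the comultiplication. -/
noncomputable def sw (x : H) (F : H → H → M) : M := tsum (comul (R := K) x) F

lemma map_sw (φ : M →ₗ[K] N) (x : H) (F : H → H → M) :
    φ (sw K x F) = sw K x (fun a b => φ (F a b)) := map_tsum φ _ _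

lemma sw_congr (x : H) {F G : H → H → M} (h : ∀ a b, F a b = G a b) :
    sw K x F = sw K x G := tsum_congr _ h

lemma sw_comm (x y : H) (F : H → H → H → H → M) :
    sw K x (fun a b => sw K y (fun c d => F a b c d)) =
      sw K y (fun c d => sw K x (fun a b => F a b c d)) := tsum_comm _ _ _

/-- linearity of Sweedler sums in the element -/
lemma sw_add (x y : H) (F : H → H → M) (hF : Bil K F) : sw K (x + y) F = sw K x F + sw K y F := by
  simp [sw, tsum_eq F hF]

lemma sw_smul (c : K) (x : H) (F : H → H → M) (hF : Bil K F) :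
    sw K (c • x) F = c • sw K x F := by
  simp [sw, tsum_eq F hF]

lemma sw_mul (x y : H) (F : H → H → M) (hF : Bil K F) :
    sw K (x * y) F = sw K x (fun a b => sw K y (fun c d => F (a * c) (b * d))) := by
  have h : ∀ t s : H ⊗[K] H, tsum (t * s) F =
      tsum t (fun a b => tsum s (fun c d => F (a * c) (b * d))) := by
    intro t s
    have hb : ∀ a b, Bil K (fun c d => F (a * c) (b * d)) := fun a b =>
      ⟨by simp [mul_add, hF.al], by simp [mul_add, hF.ar], by simp [hF.sl], by simp [hF.sr]⟩
    have hb2 : ∀ s : H ⊗[K] H, Bil K (fun a b => tsum s (fun c d => F (a * c) (b * d))) := fun s =>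
      ⟨by simp [tsum, add_mul, hF.al, Finset.sum_add_distrib],
        by simp [tsum, add_mul, hF.ar, Finset.sum_add_distrib],
        by simp [tsum, hF.sl, Finset.smul_sum], by simp [tsum, hF.sr, Finset.smul_sum]⟩
    rw [tsum_eq _ hF, tsum_eq _ (hb2 s)]
    induction t with
    | zero => simp
    | add x y hx hy => simp [add_mul, hx, hy]
    | tmul a b =>
      rw [tl_tmul, tsum_eq _ (hb a b)]
      induction s with
      | zero => simp
      | add x y hx hy => simp [mul_add, hx, hy]
      | tmul c d => simp
  simp only [sw, Bialgebra.comul_mul, h]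

lemma sw_one (F : H → H → M) (hF : Bil K F) : sw K (1 : H) F = F 1 1 := by
  rw [sw, Bialgebra.comul_one, Algebra.TensorProduct.one_def, tsum_tmul _ hF]

/-- Comodule coassociativity for Sweedler sums. -/
lemma co_assoc (δ : W →ₗ[K] W ⊗[K] H)
    (hδ : ∀ w, TensorProduct.assoc K W H H (LinearMap.rTensor H δ (δ w)) =
      LinearMap.lTensor W (comul (R := K)) (δ w))
    (w : W) (F : W → H → H → M) (h1 : ∀ c, Bil K (fun a b => F a b c))
    (h2 : ∀ a, Bil K (fun b c => F a b c)) :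
    tsum (δ w) (fun a b => tsum (δ a) (fun a' c => F a' c b)) =
      tsum (δ w) (fun a b => sw K b (fun c d => F a c d)) := by
  have hb : Bil K (fun (a : W) (t : H ⊗[K] H) => tsum t (fun c d => F a c d)) :=
    ⟨by intros; simp [tsum, (h1 _).al, Finset.sum_add_distrib],
     by intros; simp [tsum_eq _ (h2 _)],
     by intros; simp [tsum, (h1 _).sl, Finset.smul_sum],
     by intros; simp [tsum_eq _ (h2 _)]⟩
  have e := congrArg (tl _ hb) (hδ w)
  have hb2 : Bil K (fun (a : W) (b : H) => sw K b (fun c d => F a c d)) :=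
    ⟨by intros; simp [sw, tsum, (h1 _).al, Finset.sum_add_distrib],
     by intros; simp [sw_add _ _ _ (h2 _)],
     by intros; simp [sw, tsum, (h1 _).sl, Finset.smul_sum],
     by intros; simp [sw_smul _ _ _ (h2 _)]⟩
  have hb3 : Bil K (fun (a : W) (b : H) => tsum (δ a) (fun a' c => F a' c b)) :=
    ⟨by intros; simp [tsum_eq _ (h1 _)],
     by intros; simp [tsum, (h2 _).ar, Finset.sum_add_distrib],
     by intros; simp [tsum_eq _ (h1 _)],
     by intros; simp [tsum, (h2 _).sr, Finset.smul_sum]⟩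
  rw [tsum_eq _ hb2, tsum_eq _ hb3]
  have r1 : ∀ t : W ⊗[K] H, tl _ hb2 t = tl _ hb (LinearMap.lTensor W (comul (R := K)) t) := by
    intro t
    induction t with
    | zero => simp
    | add x y hx hy => simp [hx, hy]
    | tmul c d => simp [sw]
  have r3 : ∀ (t : W ⊗[K] H) (b : H), tl _ hb (TensorProduct.assoc K W H H (t ⊗ₜ b)) =
      tsum t (fun a' c => F a' c b) := by
    intro t b
    rw [tsum_eq _ (h1 b)]
    induction t with
    | zero => simp
    | add x y hx hy => simp [add_tmul, hx, hy]
    | tmul c d => simp [tsum_tmul _ (h2 _)]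
  have r2 : ∀ t : W ⊗[K] H, tl _ hb3 t =
      tl _ hb (TensorProduct.assoc K W H H (LinearMap.rTensor H δ t)) := by
    intro t
    induction t with
    | zero => simp
    | add x y hx hy => simp [hx, hy]
    | tmul c d => simp [r3]
  rw [r1, r2, e]

lemma sw_assoc (x : H) (F : H → H → H → M) (h1 : ∀ c, Bil K (fun a b => F a b c))
    (h2 : ∀ a, Bil K (fun b c => F a b c)) :
    sw K x (fun a b => sw K a (fun a' c => F a' c b)) =
      sw K x (fun a b => sw K b (fun c d => F a c d)) := by
  have := co_assoc (comul (R := K) (A := H)) (fun w => coassoc_apply w) x F h1 h2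
  simp only [sw] at this ⊢
  exact this

lemma sw_counit_left (x : H) (f : H → M) (hf : Lin K f) :
    sw K x (fun a b => counit (R := K) a • f b) = f x := by
  have hB : Bil K (fun a b => counit (R := K) (A := H) a • f b) :=
    ⟨by simp [add_smul], by simp [hf.a], by simp [mul_smul],
      fun c a b => by rw [hf.s, smul_comm]⟩
  rw [sw, tsum_eq _ hB]
  have : ∀ t : H ⊗[K] H, tl _ hB t =
      hf.mk (TensorProduct.lid K H (LinearMap.rTensor H (counit (R := K)) t)) := by
    intro t
    induction t with
    | zero => simp only [map_zero]
    | add x y hx hy => simp only [hx, hy, map_add]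
    | tmul c d => simp
  rw [this, Coalgebra.rTensor_counit_comul]; simp

lemma sw_counit_right (x : H) (f : H → M) (hf : Lin K f) :
    sw K x (fun a b => counit (R := K) b • f a) = f x := by
  have hB : Bil K (fun a b => counit (R := K) (A := H) b • f a) :=
    ⟨by simp [hf.a], by simp [add_smul], fun c a b => by rw [hf.s, smul_comm], by simp [mul_smul]⟩
  rw [sw, tsum_eq _ hB]
  have : ∀ t : H ⊗[K] H, tl _ hB t =
      hf.mk (TensorProduct.rid K H (LinearMap.lTensor H (counit (R := K)) t)) := by
    intro t
    induction t with
    | zero => simp only [map_zero]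
    | add x y hx hy => simp only [hx, hy, map_add]
    | tmul c d => simp
  rw [this, Coalgebra.lTensor_counit_comul]; simp

lemma sw_S_left (x : H) (f : H → M) (hf : Lin K f) :
    sw K x (fun a b => f (antipode K a * b)) = counit (R := K) x • f 1 := by
  have hB : Bil K (fun a b => f (antipode K a * b)) :=
    ⟨by simp [add_mul, hf.a], by simp [mul_add, hf.a], by simp [hf.s], by simp [hf.s]⟩
  rw [sw, tsum_eq _ hB]
  have h : ∀ t : H ⊗[K] H, tl _ hB t =
      hf.mk (LinearMap.mul' K H (LinearMap.rTensor H (antipode K) t)) := by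
    intro t
    induction t with
    | zero => simp only [map_zero]
    | add x y hx hy => simp only [hx, hy, map_add]
    | tmul c d => simp
  rw [h, mul_antipode_rTensor_comul_apply, Algebra.algebraMap_eq_smul_one, map_smul, hf.mk_apply]

lemma sw_S_right (x : H) (f : H → M) (hf : Lin K f) :
    sw K x (fun a b => f (a * antipode K b)) = counit (R := K) x • f 1 := by
  have hB : Bil K (fun a b => f (a * antipode K b)) :=
    ⟨by simp [add_mul, hf.a], by simp [mul_add, hf.a], by simp [hf.s], by simp [hf.s]⟩
  rw [sw, tsum_eq _ hB]
  have h : ∀ t : H ⊗[K] H, tl _ hB t =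
      hf.mk (LinearMap.mul' K H (LinearMap.lTensor H (antipode K) t)) := by
    intro t
    induction t with
    | zero => simp only [map_zero]
    | add x y hx hy => simp only [hx, hy, map_add]
    | tmul c d => simp
  rw [h, mul_antipode_lTensor_comul_apply, Algebra.algebraMap_eq_smul_one, map_smul, hf.mk_apply]


/-! Versions in which multilinearity is discharged automatically. -/

lemma swA (x : H) (F : H → H → H → M)
    (h1 : ∀ c, Bil K (fun a b => F a b c) := by (intros; constructor <;> intros <;> simp [sw, tsum, add_mul, mul_add, tmul_add, add_tmul, ← smul_tmul', add_smul, Finset.sum_add_distrib, Finset.smul_sum, Finset.mul_sum, Finset.sum_mul, smul_smul, mul_comm, mul_left_comm, mul_assoc]))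
    (h2 : ∀ a, Bil K (fun b c => F a b c) := by (intros; constructor <;> intros <;> simp [sw, tsum, add_mul, mul_add, tmul_add, add_tmul, ← smul_tmul', add_smul, Finset.sum_add_distrib, Finset.smul_sum, Finset.mul_sum, Finset.sum_mul, smul_smul, mul_comm, mul_left_comm, mul_assoc])) :
    sw K x (fun a b => sw K a (fun a' c => F a' c b)) =
      sw K x (fun a b => sw K b (fun c d => F a c d)) := sw_assoc x F h1 h2

lemma swM (x y : H) (F : H → H → M) (hF : Bil K F := by (intros; constructor <;> intros <;> simp [sw, tsum, add_mul, mul_add, tmul_add, add_tmul, ← smul_tmul', add_smul, Finset.sum_add_distrib, Finset.smul_sum, Finset.mul_sum, Finset.sum_mul, smul_smul, mul_comm, mul_left_comm, mul_assoc])) :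
    sw K (x * y) F = sw K x (fun a b => sw K y (fun c d => F (a * c) (b * d))) :=
  sw_mul x y F hF

lemma swEl (x : H) (f : H → M) (hf : Lin K f := by (intros; constructor <;> intros <;> simp [sw, tsum, add_mul, mul_add, tmul_add, add_tmul, ← smul_tmul', add_smul, Finset.sum_add_distrib, Finset.smul_sum, Finset.mul_sum, Finset.sum_mul, smul_smul, mul_comm, mul_left_comm, mul_assoc])) :
    sw K x (fun a b => counit (R := K) a • f b) = f x := sw_counit_left x f hf

lemma swEr (x : H) (f : H → M) (hf : Lin K f := by (intros; constructor <;> intros <;> simp [sw, tsum, add_mul, mul_add, tmul_add, add_tmul, ← smul_tmul', add_smul, Finset.sum_add_distrib, Finset.smul_sum, Finset.mul_sum, Finset.sum_mul, smul_smul, mul_comm, mul_left_comm, mul_assoc])) :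
    sw K x (fun a b => counit (R := K) b • f a) = f x := sw_counit_right x f hf

lemma swSl (x : H) (f : H → M) (hf : Lin K f := by (intros; constructor <;> intros <;> simp [sw, tsum, add_mul, mul_add, tmul_add, add_tmul, ← smul_tmul', add_smul, Finset.sum_add_distrib, Finset.smul_sum, Finset.mul_sum, Finset.sum_mul, smul_smul, mul_comm, mul_left_comm, mul_assoc])) :
    sw K x (fun a b => f (antipode K a * b)) = counit (R := K) x • f 1 := sw_S_left x f hf

lemma swSr (x : H) (f : H → M) (hf : Lin K f := by (intros; constructor <;> intros <;> simp [sw, tsum, add_mul, mul_add, tmul_add, add_tmul, ← smul_tmul', add_smul, Finset.sum_add_distrib, Finset.smul_sum, Finset.mul_sum, Finset.sum_mul, smul_smul, mul_comm, mul_left_comm, mul_assoc])) :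
    sw K x (fun a b => f (a * antipode K b)) = counit (R := K) x • f 1 := sw_S_right x f hf


lemma sw_smul_right (c : K) (x : H) (F : H → H → M) :
    sw K x (fun a b => c • F a b) = c • sw K x F := by simp [sw, tsum_smul]

lemma sw_self (x : H) : sw K x (fun a b => a ⊗ₜ[K] b) = comul (R := K) x := tsum_self _

/-- The antipode reverses the comultiplication (function form). -/
lemma comul_antipode (x : H) :
    comul (R := K) (antipode K x) =
      sw K x (fun a b => (antipode K b) ⊗ₜ[K] (antipode K a)) := by
  -- Both sides are convolution inverse to `comul`.
  have hb0 : Bil K (fun a b : H => (antipode K b) ⊗ₜ[K] (antipode K a)) :=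
    ⟨by simp [tmul_add], by simp [add_tmul], by simp, by simp [smul_tmul']⟩
  let G : H →ₗ[K] H ⊗[K] H := tl _ hb0 ∘ₗ comul
  have hG : ∀ y, G y = sw K y (fun a b => (antipode K b) ⊗ₜ[K] (antipode K a)) := by
    intro y; simp [G, sw, tsum_eq _ hb0]
  have key : WithConv.toConv (comul ∘ₗ antipode K : H →ₗ[K] H ⊗[K] H) = WithConv.toConv G := by
    symm
    refine left_inv_eq_right_inv (a := WithConv.toConv (comul (R := K) (A := H))) ?_
      LinearMap.comul_right_inv
    apply WithConv.ext
    ext y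
    change LinearMap.mul' K (H ⊗[K] H) (TensorProduct.map G (comul (R := K)) (comul (R := K) y)) =
      algebraMap K _ (counit (R := K) y)
    rw [← sw_self y]
    rw [map_sw, map_sw]
    calc _ = sw K y (fun a b => G a * comul b) := by
          apply sw_congr; intro a b; simp
      _ = sw K y (fun a b => sw K a (fun a1 a2 =>
            sw K b (fun b1 b2 => (antipode K a2 * b1) ⊗ₜ[K] (antipode K a1 * b2)))) := by
          apply sw_congr; intro a b
          rw [hG, ← LinearMap.mulRight_apply K, map_sw]
          apply sw_congr; intro a1 a2
          rw [LinearMap.mulRight_apply, ← sw_self b, ← LinearMap.mulLeft_apply K, map_sw]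
          apply sw_congr; intro b1 b2
          simp
      _ = sw K y (fun a1 r => sw K r (fun a2 b =>
            sw K b (fun b1 b2 => (antipode K a2 * b1) ⊗ₜ[K] (antipode K a1 * b2)))) :=
          swA y (fun a1 a2 b => sw K b (fun b1 b2 => (antipode K a2 * b1) ⊗ₜ[K] (antipode K a1 * b2)))
      _ = sw K y (fun a1 r => sw K r (fun c b2 =>
            sw K c (fun a2 b1 => (antipode K a2 * b1) ⊗ₜ[K] (antipode K a1 * b2)))) := by
          apply sw_congr; intro a1 r
          exact (swA r (fun a2 b1 b2 => (antipode K a2 * b1) ⊗ₜ[K] (antipode K a1 * b2))).symm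
      _ = sw K y (fun a1 r => sw K r (fun c b2 =>
            counit (R := K) c • ((1 : H) ⊗ₜ[K] (antipode K a1 * b2)))) := by
          apply sw_congr; intro a1 r
          apply sw_congr; intro c b2
          exact swSl c (fun z => z ⊗ₜ[K] (antipode K a1 * b2))
      _ = sw K y (fun a1 r => (1 : H) ⊗ₜ[K] (antipode K a1 * r)) := by
          apply sw_congr; intro a1 r
          exact swEl r (fun b2 => (1 : H) ⊗ₜ[K] (antipode K a1 * b2))
      _ = _ := by
          rw [swSl y (fun z => (1 : H) ⊗ₜ[K] z), Algebra.algebraMap_eq_smul_one,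
            Algebra.TensorProduct.one_def]
  have := congrArg (fun f => f.ofConv x) key
  simpa [hG] using this

lemma swS (x : H) (F : H → H → M) (hF : Bil K F := by (intros; constructor <;> intros <;> simp [sw, tsum, add_mul, mul_add, tmul_add, add_tmul, ← smul_tmul', add_smul, Finset.sum_add_distrib, Finset.smul_sum, Finset.mul_sum, Finset.sum_mul, smul_smul, mul_comm, mul_left_comm, mul_assoc])) :
    sw K (antipode K x) F = sw K x (fun a b => F (antipode K b) (antipode K a)) := by
  rw [sw, tsum_eq _ hF, comul_antipode, map_sw]; rfl

end hopf
end SD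

namespace SD
set_option linter.all false
open TensorProduct Coalgebra HopfAlgebra

section intg
variable {K : Type*} [Field K]
variable {H : Type*} [Ring H] [HopfAlgebra K H]

/-- A semisimple Hopf algebra has a normalized two-sided integral. -/
lemma exists_integral [IsSemisimpleRing H] : ∃ Λ : H, (∀ h : H, h * Λ = counit (R := K) h • Λ) ∧
    (∀ h : H, Λ * h = counit (R := K) h • Λ) ∧ counit (R := K) Λ = 1 := by
  classical
  let I : Ideal H := RingHom.ker (Bialgebra.counitAlgHom K H)
  have hI : ∀ x : H, x ∈ I ↔ counit (R := K) x = 0 := fun x => by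
    simp [I, RingHom.mem_ker]
  obtain ⟨J, hJ⟩ := exists_isCompl I
  have h1 : (1 : H) ∈ I ⊔ J := by rw [hJ.sup_eq_top]; trivial
  obtain ⟨y, hy, L, hL, hyL⟩ := Submodule.mem_sup.1 h1
  have e1 : counit (R := K) L = 1 := by
    have := congrArg (counit (R := K) (A := H)) hyL
    simpa [(hI y).1 hy] using this
  have left : ∀ h : H, h * L = counit (R := K) h • L := by
    intro h
    have m1 : (h - algebraMap K H (counit (R := K) h)) * L ∈ J := J.mul_mem_left _ hL
    have m2 : (h - algebraMap K H (counit (R := K) h)) * L ∈ I := by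
      rw [hI]; simp [sub_mul]
    have : (h - algebraMap K H (counit (R := K) h)) * L = 0 := by
      have := hJ.disjoint.le_bot (show _ ∈ I ⊓ J from ⟨m2, m1⟩)
      simpa using this
    rw [sub_mul, sub_eq_zero] at this
    rw [this, Algebra.smul_def]
  refine ⟨L, left, ?_, e1⟩
  let N : Ideal H :=
    { carrier := {x | (∀ g : H, g * x = counit (R := K) g • x) ∧ counit (R := K) x = 0}
      add_mem' := by
        rintro a b ⟨ha, ha'⟩ ⟨hb, hb'⟩
        exact ⟨fun g => by rw [mul_add, ha, hb, smul_add], by simp [ha', hb']⟩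
      zero_mem' := ⟨by simp, by simp⟩
      smul_mem' := by
        rintro c x ⟨hx, hx'⟩
        refine ⟨fun g => ?_, by simp [hx']⟩
        rw [smul_eq_mul, hx c, mul_smul_comm, hx, smul_comm] }
  have hN : ∀ x ∈ N, ∀ y ∈ N, x * y = 0 := by
    rintro x ⟨_, hx⟩ y ⟨hy, _⟩
    rw [hy x, hx, zero_smul]
  have hN0 : ∀ x ∈ N, x = 0 := by
    intro x hx
    obtain ⟨N', hN'⟩ := exists_isCompl N
    have h1 : (1 : H) ∈ N ⊔ N' := by rw [hN'.sup_eq_top]; trivial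
    obtain ⟨e, he, e', he', hee⟩ := Submodule.mem_sup.1 h1
    have hxe : x = x * e' := by
      conv_lhs => rw [← mul_one x, ← hee, mul_add, hN x hx e he, zero_add]
    have : x ∈ N ⊓ N' := ⟨hx, by rw [hxe]; exact N'.mul_mem_left _ he'⟩
    simpa using hN'.disjoint.le_bot this
  intro h
  rw [← sub_eq_zero]
  apply hN0
  refine ⟨fun g => ?_, by simp [mul_comm]⟩
  rw [mul_sub, ← mul_assoc, left g, smul_mul_assoc, mul_smul_comm, left g, smul_sub,
    smul_comm (counit (R := K) h)]
end intg

section lam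
variable {K : Type*} [Field K]
variable {H : Type*} [Ring H] [HopfAlgebra K H] [FiniteDimensional K H]

/-- Sweedler sum as a linear map. -/
noncomputable def swL {M : Type*} [AddCommGroup M] [Module K M] (F : H → H → M)
    (hF : Bil K F := by (intros; constructor <;> intros <;> simp [sw, tsum, add_mul, mul_add, tmul_add, add_tmul, ← smul_tmul', add_smul, Finset.sum_add_distrib, Finset.smul_sum, Finset.mul_sum, Finset.sum_mul, smul_smul, mul_comm, mul_left_comm, mul_assoc])) : H →ₗ[K] M :=
  tl F hF ∘ₗ comul

lemma swL_apply {M : Type*} [AddCommGroup M] [Module K M] (F : H → H → M) (hF : Bil K F) (x : H) :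
    swL F hF x = sw K x F := (tsum_eq F hF _).symm

variable (K H) in
/-- the square of the antipode -/
noncomputable def S2 : H →ₗ[K] H := antipode K ∘ₗ antipode K

lemma S2_apply (x : H) : S2 K H x = antipode K (antipode K x) := rfl

lemma S2_mul (x y : H) : S2 K H (x * y) = S2 K H x * S2 K H y := by
  simp [S2_apply, antipode_mul_antidistrib]

variable (K H) in
/-- the integral on `H` -/
noncomputable def lam : H →ₗ[K] K where
  toFun h := LinearMap.trace K H (LinearMap.mulLeft K h ∘ₗ S2 K H)
  map_add' x y := by
    rw [← map_add]; congr 1; ext z; simp [add_mul]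
  map_smul' c y := by
    rw [RingHom.id_apply, ← map_smul]; congr 1; ext z; simp

lemma lam_apply (h : H) : lam K H h = LinearMap.trace K H (LinearMap.mulLeft K h ∘ₗ S2 K H) := rfl

lemma lam_integral_aux (φ : H →ₗ[K] K) (h : H) :
    sw K h (fun a b => φ a * lam K H b) = φ 1 * lam K H h := by
  let e := Module.finBasis K H
  let A : Fin (Module.finrank K H) → H →ₗ[K] H := fun i =>
    swL (fun x y => e.coord i (antipode K x) • (h * S2 K H y))
  let B : Fin (Module.finrank K H) → H →ₗ[K] H := fun i => swL (fun x y => φ (x * e i) • y)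
  have hA : ∀ i x, A i x = sw K x (fun x y => e.coord i (antipode K x) • (h * S2 K H y)) :=
    fun i x => swL_apply _ _ x
  have hB : ∀ i x, B i x = sw K x (fun x y => φ (x * e i) • y) := fun i x => swL_apply _ _ x
  have hsum : ∀ (y : H), ∑ i, e.coord i y • e i = y := fun y => by
    simpa using e.sum_repr y
  have AB : ∑ i, A i ∘ₗ B i = φ 1 • (LinearMap.mulLeft K h ∘ₗ S2 K H) := by
    ext x
    simp only [LinearMap.sum_apply, LinearMap.comp_apply, LinearMap.smul_apply,
      LinearMap.mulLeft_apply]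
    calc ∑ i, A i (B i x) = ∑ i, sw K x (fun a b => φ (a * e i) •
            sw K b (fun c d => e.coord i (antipode K c) • (h * S2 K H d))) := by
          apply Finset.sum_congr rfl; intro i _
          rw [hB, map_sw]; apply sw_congr; intro a b
          rw [map_smul, hA]
      _ = sw K x (fun a b => sw K b (fun c d => φ (a * antipode K c) • (h * S2 K H d))) := by
          simp only [sw, tsum]
          rw [Finset.sum_comm]
          apply Finset.sum_congr rfl; intro j _
          simp only [Finset.smul_sum]
          rw [Finset.sum_comm]
          apply Finset.sum_congr rfl; intro k _
          simp only [smul_smul]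
          rw [← Finset.sum_smul]
          congr 1
          conv_rhs => rw [← hsum (antipode K _), Finset.mul_sum, map_sum]
          apply Finset.sum_congr rfl; intro i _
          rw [mul_smul_comm, map_smul, smul_eq_mul, mul_comm]
      _ = sw K x (fun r d => sw K r (fun a c => φ (a * antipode K c) • (h * S2 K H d))) :=
          (swA x (fun a c d => φ (a * antipode K c) • (h * S2 K H d))).symm
      _ = sw K x (fun r d => counit (R := K) r • (φ 1 • (h * S2 K H d))) := by
          apply sw_congr; intro r d
          exact swSr r (fun z => φ z • (h * S2 K H d))
      _ = _ := swEl x (fun d => φ 1 • (h * S2 K H d))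
  have BA : ∑ i, B i ∘ₗ A i = sw K h (fun a b => φ a • (LinearMap.mulLeft K b ∘ₗ S2 K H)) := by
    ext x
    have ev : ∀ T : H →ₗ[K] H, T x = LinearMap.applyₗ (R := K) x T := fun T => rfl
    rw [ev (sw K h _), map_sw]
    simp only [LinearMap.sum_apply, LinearMap.comp_apply, LinearMap.applyₗ_apply_apply,
      LinearMap.smul_apply, LinearMap.mulLeft_apply]
    calc ∑ i, B i (A i x) = ∑ i, sw K x (fun a b => e.coord i (antipode K a) •
            sw K (h * S2 K H b) (fun c d => φ (c * e i) • d)) := by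
          apply Finset.sum_congr rfl; intro i _
          rw [hA, map_sw]; apply sw_congr; intro a b
          rw [map_smul, hB]
      _ = sw K x (fun a b => sw K (h * S2 K H b) (fun c d => φ (c * antipode K a) • d)) := by
          simp only [sw, tsum]
          rw [Finset.sum_comm]
          apply Finset.sum_congr rfl; intro j _
          simp only [Finset.smul_sum]
          rw [Finset.sum_comm]
          apply Finset.sum_congr rfl; intro k _
          simp only [smul_smul]
          rw [← Finset.sum_smul]
          congr 1
          conv_rhs => rw [← hsum (antipode K _), Finset.mul_sum, map_sum]
          apply Finset.sum_congr rfl; intro i _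
          rw [mul_smul_comm, map_smul, smul_eq_mul, mul_comm]
      _ = sw K x (fun a b => sw K h (fun c d => sw K b (fun b1 b2 =>
            φ (c * (S2 K H b1 * antipode K a)) • (d * S2 K H b2)))) := by
          apply sw_congr; intro a b
          rw [swM h (S2 K H b) (fun c d => φ (c * antipode K a) • d)]
          apply sw_congr; intro c d
          rw [S2_apply, swS _ (fun p q => φ (c * p * antipode K a) • (d * q)),
            swS _ (fun p q => φ (c * antipode K q * antipode K a) • (d * antipode K p))]
          apply sw_congr; intro b1 b2
          simp [S2_apply, mul_assoc]
      _ = sw K h (fun c d => sw K x (fun a b => sw K b (fun b1 b2 =>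
            φ (c * (S2 K H b1 * antipode K a)) • (d * S2 K H b2)))) := sw_comm _ _ _
      _ = sw K h (fun c d => sw K x (fun r b2 => sw K r (fun a b1 =>
            φ (c * (S2 K H b1 * antipode K a)) • (d * S2 K H b2)))) := by
          apply sw_congr; intro c d
          exact (swA x (fun a b1 b2 => φ (c * (S2 K H b1 * antipode K a)) • (d * S2 K H b2))).symm
      _ = sw K h (fun c d => sw K x (fun r b2 => counit (R := K) r • (φ c • (d * S2 K H b2)))) := by
          apply sw_congr; intro c d
          apply sw_congr; intro r b2
          have := swSr (K := K) r (fun z => φ (c * antipode K z) • (d * S2 K H b2))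
          simp only [antipode_mul_antidistrib, antipode_one, mul_one] at this
          rw [← this]; rfl
      _ = _ := by
          apply sw_congr; intro c d
          exact swEl x (fun b2 => φ c • (d * S2 K H b2))
  have t : LinearMap.trace K H (∑ i, A i ∘ₗ B i) = LinearMap.trace K H (∑ i, B i ∘ₗ A i) := by
    simp only [map_sum]
    apply Finset.sum_congr rfl; intro i _
    exact LinearMap.trace_comp_comm' _ _
  rw [AB, BA, map_smul, map_sw] at t
  simp only [map_smul, smul_eq_mul, ← lam_apply] at t
  exact t.symm

/-- elements of a vector space are determined by functionals -/
lemma ext_dual {M : Type*} [AddCommGroup M] [Module K M] {x y : M}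
    (h : ∀ φ : M →ₗ[K] K, φ x = φ y) : x = y := by
  rw [← sub_eq_zero, ← Module.forall_dual_apply_eq_zero_iff K]
  intro φ; rw [map_sub, h, sub_self]

lemma lam_integral (h : H) : sw K h (fun a b => lam K H b • a) = lam K H h • (1 : H) := by
  apply ext_dual (K := K)
  intro φ
  rw [map_sw, map_smul, smul_eq_mul, mul_comm, ← lam_integral_aux]
  apply sw_congr; intro a b
  rw [map_smul, smul_eq_mul, mul_comm]

lemma lam_Lam {Λ : H} (hl : ∀ h : H, h * Λ = counit (R := K) h • Λ)
    (hr : ∀ h : H, Λ * h = counit (R := K) h • Λ) (h1 : counit (R := K) Λ = 1) :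
    lam K H Λ = 1 := by
  rw [lam_apply]
  have : LinearMap.mulLeft K Λ ∘ₗ S2 K H = LinearMap.smulRight (counit (R := K) (A := H)) Λ := by
    ext x; simp [hr, S2_apply]
  rw [this, LinearMap.trace_smulRight, h1]

end lam
end SD

namespace SD
set_option linter.all false
open TensorProduct Coalgebra HopfAlgebra

section B2
variable {K : Type*} [Field K]
variable {H : Type*} [Ring H] [HopfAlgebra K H] [FiniteDimensional K H]

/-- normalized two-sided integrals -/
structure Intg (K : Type*) [Field K] {H : Type*} [Ring H] [HopfAlgebra K H] (Λ : H) : Prop where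
  l : ∀ h : H, h * Λ = counit (R := K) h • Λ
  r : ∀ h : H, Λ * h = counit (R := K) h • Λ
  e : counit (R := K) Λ = 1

local notation "lm" => lam K H
local notation "S" => antipode K (A := H)

lemma Intg.lam {Λ : H} (I : Intg K Λ) : lm Λ = 1 := lam_Lam I.l I.r I.e

lemma id1 (x y : H) : sw K x (fun a b => lm (b * S y) • a) =
    sw K y (fun c d => lm (x * S c) • d) := by
  symm
  calc sw K y (fun c d => lm (x * S c) • d)
      = sw K y (fun c d => sw K x (fun a b => sw K c (fun c1 c2 => lm (b * S c1) • (a * (S c2 * d))))) := by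
        apply sw_congr; intro c d
        have h := congrArg (LinearMap.mulRight K d) (lam_integral (K := K) (x * S c))
        rw [map_sw] at h
        simp only [map_smul, LinearMap.mulRight_apply, one_mul] at h
        rw [← h, swM x (S c) (fun a b => lm b • (a * d))]
        apply sw_congr; intro a b
        rw [swS c (fun p q => lm (b * q) • (a * p * d))]
        simp only [mul_assoc]
    _ = sw K x (fun a b => sw K y (fun c d => sw K c (fun c1 c2 => lm (b * S c1) • (a * (S c2 * d))))) :=
        sw_comm _ _ _
    _ = sw K x (fun a b => sw K y (fun c1 r => sw K r (fun c2 d => lm (b * S c1) • (a * (S c2 * d))))) := by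
        apply sw_congr; intro a b
        exact swA y (fun c1 c2 d => lm (b * S c1) • (a * (S c2 * d)))
    _ = sw K x (fun a b => sw K y (fun c1 r => counit (R := K) r • (lm (b * S c1) • a))) := by
        apply sw_congr; intro a b
        apply sw_congr; intro c1 r
        have := swSl (K := K) r (fun z => lm (b * S c1) • (a * z))
        rw [mul_one] at this; exact this
    _ = _ := by
        apply sw_congr; intro a b
        exact swEr y (fun c1 => lm (b * S c1) • a)

lemma id2 (x y : H) : sw K y (fun c d => lm (x * d) • c) =
    sw K x (fun a b => lm (b * y) • S a) := by
  symm
  calc sw K x (fun a b => lm (b * y) • S a)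
      = sw K x (fun a b => sw K b (fun b1 b2 => sw K y (fun c d => lm (b2 * d) • (S a * b1 * c)))) := by
        apply sw_congr; intro a b
        have h := congrArg (LinearMap.mulLeft K (S a)) (lam_integral (K := K) (b * y))
        rw [map_sw] at h
        simp only [map_smul, LinearMap.mulLeft_apply, mul_one] at h
        rw [← h, swM b y (fun p q => lm q • (S a * p))]
        simp only [mul_assoc]
    _ = sw K x (fun r b2 => sw K r (fun a b1 => sw K y (fun c d => lm (b2 * d) • (S a * b1 * c)))) :=
        (swA x (fun a b1 b2 => sw K y (fun c d => lm (b2 * d) • (S a * b1 * c)))).symm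
    _ = sw K x (fun r b2 => counit (R := K) r • sw K y (fun c d => lm (b2 * d) • c)) := by
        apply sw_congr; intro r b2
        have := swSl (K := K) r (fun z => sw K y (fun c d => lm (b2 * d) • (z * c)))
        simp only [one_mul] at this; exact this
    _ = _ := swEl x (fun b2 => sw K y (fun c d => lm (b2 * d) • c))

variable {Λ : H} (I : Intg K Λ)
include I

lemma id3 (y : H) : sw K Λ (fun a b => lm (b * S y) • a) = y := by
  rw [id1]
  simp only [I.r, map_smul, smul_eq_mul, I.lam, mul_one, counit_antipode]
  exact swEl y (fun d => d)

lemma S_inj : Function.Injective (antipode K (A := H)) := by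
  rw [injective_iff_map_eq_zero]
  intro y hy
  rw [← id3 I y, hy]
  simp [sw, tsum]

lemma S_surj : Function.Surjective (antipode K (A := H)) :=
  LinearMap.surjective_of_injective (S_inj I)

lemma id4 (x : H) : sw K Λ (fun a b => lm (x * b) • a) = S x := by
  rw [id2]
  simp only [I.l, map_smul, smul_eq_mul, I.lam, mul_one]
  exact swEr x (fun d => S d)

lemma lam_nondeg (x : H) (h : ∀ y, lm (x * y) = 0) : x = 0 := by
  apply S_inj I
  rw [← id4 I x]; simp [h, sw, tsum]

lemma Lam_inj {f g : H →ₗ[K] K}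
    (h : sw K Λ (fun a b => f b • a) = sw K Λ (fun a b => g b • a)) : f = g := by
  let T : (H →ₗ[K] K) →ₗ[K] H :=
    { toFun := fun f => sw K Λ (fun a b => f b • a)
      map_add' := by intros; simp [sw, tsum, add_smul, Finset.sum_add_distrib]
      map_smul' := by intros; simp [sw, tsum, mul_smul, Finset.smul_sum] }
  have hs : Function.Surjective T := by
    intro y
    obtain ⟨x, rfl⟩ := S_surj I y
    exact ⟨lm ∘ₗ LinearMap.mulLeft K x, id4 I x⟩
  have hi : Function.Injective T :=
    (LinearMap.injective_iff_surjective_of_finrank_eq_finrank (Subspace.dual_finrank_eq)).2 hs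
  exact hi h

lemma nakayama (x y : H) : lm (x * y) = lm (y * S2 K H x) := by
  have : lm ∘ₗ LinearMap.mulLeft K x = lm ∘ₗ LinearMap.mulRight K (S2 K H x) := by
    apply Lam_inj I
    exact (id4 I x).trans (id3 I (S x)).symm
  exact LinearMap.congr_fun this y

lemma trace_formula (A : H →ₗ[K] H) :
    LinearMap.trace K H A = sw K Λ (fun a b => lm (b * S (A a))) := by
  have : A = sw K Λ (fun a b => LinearMap.smulRight (lm ∘ₗ LinearMap.mulLeft K b ∘ₗ S) (A a)) := by
    ext y
    have ev : ∀ T : H →ₗ[K] H, T y = LinearMap.applyₗ (R := K) y T := fun T => rfl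
    rw [ev (sw K Λ _), map_sw]
    conv_lhs => rw [← id3 I y, map_sw]
    apply sw_congr; intro a b
    simp
  conv_lhs => rw [this]
  rw [map_sw]
  apply sw_congr; intro a b
  rw [LinearMap.trace_smulRight]; rfl

lemma lam_unique (ψ : H →ₗ[K] K) (hψ : ∀ h, sw K h (fun a b => ψ b • a) = ψ h • (1 : H)) :
    ψ = ψ Λ • lm := by
  let T : H →ₗ[K] (H →ₗ[K] K) :=
    { toFun := fun z => lm ∘ₗ LinearMap.mulLeft K z
      map_add' := by intros; ext; simp [add_mul]
      map_smul' := by intros; ext; simp }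
  have hi : Function.Injective T := by
    rw [injective_iff_map_eq_zero]
    intro z hz
    exact lam_nondeg I z (fun y => LinearMap.congr_fun hz y)
  have hs : Function.Surjective T :=
    (LinearMap.injective_iff_surjective_of_finrank_eq_finrank
      (Subspace.dual_finrank_eq (K := K) (V := H)).symm).1 hi
  obtain ⟨z, hz⟩ := hs ψ
  have hz' : ∀ y, ψ y = lm (z * y) := fun y => (LinearMap.congr_fun hz y).symm
  have h1 := hψ Λ
  have h2 := id4 I z
  simp only [← hz'] at h2
  rw [h1] at h2
  have h3 : z = ψ Λ • 1 := by
    apply S_inj I; rw [← h2, map_smul, antipode_one]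
  ext y
  rw [hz', LinearMap.smul_apply]
  conv_lhs => rw [h3]
  rw [smul_mul_assoc, one_mul, map_smul]

omit I in
variable (K) in
/-- the modular element -/
noncomputable def gl (Λ : H) : H := sw K Λ (fun a b => lm a • b)

local notation "ga" => gl K Λ

lemma lam_right (h : H) : sw K h (fun a b => lm a • b) = lm h • ga := by
  apply ext_dual (K := K)
  intro φ
  let ψ : H →ₗ[K] K := swL (fun a b => lm a * φ b)
  have hψ : ∀ x, ψ x = sw K x (fun a b => lm a * φ b) := swL_apply _ _
  have hu : ψ = ψ Λ • lm := by
    apply lam_unique I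
    intro x
    calc sw K x (fun a b => ψ b • a)
        = sw K x (fun a b => sw K b (fun c d => (lm c * φ d) • a)) := by
          apply sw_congr; intro a b
          rw [hψ]; simp [sw, tsum, Finset.sum_smul]
      _ = sw K x (fun r d => sw K r (fun a c => (lm c * φ d) • a)) :=
          (swA x (fun a c d => (lm c * φ d) • a)).symm
      _ = sw K x (fun r d => (lm r * φ d) • (1 : H)) := by
          apply sw_congr; intro r d
          have := lam_integral (K := K) r
          calc _ = φ d • sw K r (fun a c => lm c • a) := by
                simp [sw, tsum, Finset.smul_sum, smul_smul, mul_comm]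
            _ = _ := by rw [this, smul_smul, mul_comm]
      _ = _ := by rw [hψ]; simp [sw, tsum, Finset.sum_smul]
  have e1 := LinearMap.congr_fun hu h
  rw [LinearMap.smul_apply, hψ, hψ] at e1
  rw [map_sw, map_smul, gl, map_sw]
  simp only [map_smul, smul_eq_mul] at e1 ⊢
  rw [e1, mul_comm]

lemma gl_counit : counit (R := K) ga = 1 := by
  rw [gl, map_sw]
  simp only [map_smul, smul_eq_mul]
  have := swEr (K := K) Λ (fun a => lm a)
  simp only [smul_eq_mul, I.lam] at this
  rw [← this]; apply sw_congr; intros; rw [mul_comm]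

lemma gl_comul : comul (R := K) ga = ga ⊗ₜ[K] ga := by
  calc comul (R := K) ga = sw K Λ (fun a b => lm a • comul (R := K) b) := by
        conv_lhs => rw [gl, map_sw]
        simp only [map_smul]
    _ = sw K Λ (fun a b => sw K b (fun c d => lm a • c ⊗ₜ[K] d)) := by
        apply sw_congr; intro a b
        rw [sw_smul_right, sw_self]
    _ = sw K Λ (fun r d => sw K r (fun a c => lm a • c ⊗ₜ[K] d)) :=
        (swA Λ (fun a c d => lm a • c ⊗ₜ[K] d)).symm
    _ = sw K Λ (fun r d => lm r • ga ⊗ₜ[K] d) := by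
        apply sw_congr; intro r d
        have h := congrArg (fun z => z ⊗ₜ[K] d) (lam_right I r)
        simp only [← smul_tmul'] at h
        rw [← h]
        simp [sw, tsum, sum_tmul, smul_tmul']
    _ = _ := by
        conv_rhs => arg 3; rw [gl]
        simp [sw, tsum, tmul_sum]

lemma gl_order : ∃ m : ℕ, 0 < m ∧ ga ^ m = 1 := by
  have hg : IsGroupLikeElem K ga := ⟨gl_counit I, gl_comul I⟩
  by_contra hne
  push Not at hne
  have hunit : IsUnit ga := hg.isUnit
  have hinj : Function.Injective (fun n : ℕ => ga ^ n) := by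
    intro i j hij
    simp only at hij
    rcases lt_trichotomy i j with h | h | h
    · exfalso; apply hne (j - i) (by omega)
      apply (hunit.pow i).mul_left_cancel
      rw [← pow_add, mul_one, hij]; congr 1; omega
    · exact h
    · exfalso; apply hne (i - j) (by omega)
      apply (hunit.pow j).mul_left_cancel
      rw [← pow_add, mul_one, ← hij]; congr 1; omega
  have hli : LinearIndependent K (fun n : ℕ => ga ^ n) := by
    have h0 := linearIndepOn_isGroupLikeElem (R := K) (A := H)
    have := h0.comp (fun n : ℕ => (⟨ga ^ n, hg.pow⟩ : {a : H | IsGroupLikeElem K a}))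
      (fun i j hij => hinj (by simpa using hij))
    exact this
  exact (not_finite_iff_infinite.2 (inferInstanceAs (Infinite ℕ))) hli.finite

lemma id5 (x y : H) : sw K x (fun a b => lm (a * y) • b) =
    sw K y (fun c d => lm (x * c) • (ga * S d)) := by
  symm
  calc sw K y (fun c d => lm (x * c) • (ga * S d))
      = sw K y (fun c d => sw K x (fun a b => sw K c (fun c1 c2 => lm (a * c1) • (b * (c2 * S d))))) := by
        apply sw_congr; intro c d
        have h := congrArg (LinearMap.mulRight K (S d)) (lam_right I (x * c))
        rw [map_sw] at h
        simp only [map_smul, LinearMap.mulRight_apply] at h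
        rw [← h, swM x c (fun a b => lm a • (b * S d))]
        simp only [mul_assoc]
    _ = sw K x (fun a b => sw K y (fun c d => sw K c (fun c1 c2 => lm (a * c1) • (b * (c2 * S d))))) :=
        sw_comm _ _ _
    _ = sw K x (fun a b => sw K y (fun c1 r => sw K r (fun c2 d => lm (a * c1) • (b * (c2 * S d))))) := by
        apply sw_congr; intro a b
        exact swA y (fun c1 c2 d => lm (a * c1) • (b * (c2 * S d)))
    _ = sw K x (fun a b => sw K y (fun c1 r => counit (R := K) r • (lm (a * c1) • b))) := by
        apply sw_congr; intro a b
        apply sw_congr; intro c1 r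
        have := swSr (K := K) r (fun z => lm (a * c1) • (b * z))
        rw [mul_one] at this; exact this
    _ = _ := by
        apply sw_congr; intro a b
        exact swEr y (fun c1 => lm (a * c1) • b)

lemma id6 (z y : H) : sw K y (fun c d => lm (S z * c) • d) =
    sw K z (fun a b => lm (S b * y) • (a * ga)) := by
  symm
  calc sw K z (fun a b => lm (S b * y) • (a * ga))
      = sw K z (fun a b => sw K b (fun b1 b2 => sw K y (fun c d => lm (S b2 * c) • (a * S b1 * d)))) := by
        apply sw_congr; intro a b
        have h := congrArg (LinearMap.mulLeft K a) (lam_right I (S b * y))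
        rw [map_sw] at h
        simp only [map_smul, LinearMap.mulLeft_apply] at h
        rw [← h, swM (S b) y (fun p q => lm p • (a * q)),
          swS b (fun p q => sw K y (fun c d => lm (p * c) • (a * (q * d))))]
        simp only [mul_assoc]
    _ = sw K z (fun r b2 => sw K r (fun a b1 => sw K y (fun c d => lm (S b2 * c) • (a * S b1 * d)))) :=
        (swA z (fun a b1 b2 => sw K y (fun c d => lm (S b2 * c) • (a * S b1 * d)))).symm
    _ = sw K z (fun r b2 => counit (R := K) r • sw K y (fun c d => lm (S b2 * c) • d)) := by
        apply sw_congr; intro r b2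
        have := swSr (K := K) r (fun z => sw K y (fun c d => lm (S b2 * c) • (z * d)))
        simp only [one_mul] at this; exact this
    _ = _ := swEl z (fun b2 => sw K y (fun c d => lm (S b2 * c) • d))

lemma S4_conj (z : H) : z * ga = ga * S2 K H (S2 K H z) := by
  have e1 := id6 I z Λ
  have e2 := id5 I Λ (S2 K H (S z))
  have e3 : sw K Λ (fun c d => lm (S z * c) • d) = sw K Λ (fun a b => lm (a * S2 K H (S z)) • b) := by
    apply sw_congr; intro a b
    rw [nakayama I (S z) a]
  rw [e1, e2] at e3
  simp only [I.l, I.r, map_smul, smul_eq_mul, I.lam, mul_one, counit_antipode] at e3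
  rw [swEr z (fun a => a * ga), swEl (S2 K H (S z)) (fun b => ga * S b)] at e3
  exact e3

lemma S4_pow : ∃ m : ℕ, 0 < m ∧ ∀ z, ((S2 K H)^(2*m)) z = z := by
  obtain ⟨m, hm, h1⟩ := gl_order I
  refine ⟨m, hm, fun z => ?_⟩
  have key : ∀ k : ℕ, ∀ z, z * ga ^ k = ga ^ k * ((S2 K H)^(2*k)) z := by
    intro k
    induction k with
    | zero => intro z; simp
    | succ k ih =>
      intro z
      rw [pow_succ', ← mul_assoc, S4_conj I z, mul_assoc, ih, ← mul_assoc]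
      rw [show 2 * (k+1) = 2 * k + 1 + 1 by ring, pow_succ _ (2*k+1), pow_succ _ (2*k)]; rfl
  have := key m z
  rw [h1, mul_one, one_mul] at this
  exact this.symm

lemma S4_one (h : lm 1 ≠ 0) (z : H) : S2 K H (S2 K H z) = z := by
  have hb : Bil K (fun a b : H => lm a • b) :=
    ⟨by intros; simp [add_smul], by intros; simp, by intros; simp [smul_smul],
     by intros; simp [smul_smul, mul_comm]⟩
  have h1 := lam_right I 1
  rw [sw_one _ hb] at h1
  have h2 : (1 : H) = ga := smul_right_injective H h h1
  have h3 := S4_conj I z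
  rw [← h2] at h3
  simpa using h3.symm

end B2
end SD

namespace SD
set_option linter.all false

section trace
variable {K : Type*} [Field K] [IsAlgClosed K]
open Module.End

lemma trace_gen {M : Type*} [AddCommGroup M] [Module K M] [FiniteDimensional K M]
    (A C : Module.End K M) (h : Commute A C) :
    ∃ F : Finset K, (∀ μ ∈ F, A.HasEigenvalue μ) ∧ ∀ i : ℕ, ∀ j : ℕ,
      LinearMap.trace K M (A ^ i * C ^ j) = ∑ μ ∈ F, μ ^ i * LinearMap.trace K _
        ((C.restrict (mapsTo_maxGenEigenspace_of_comm h μ)) ^ j) := by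
  classical
  have hInternal : DirectSum.IsInternal A.maxGenEigenspace :=
    DirectSum.isInternal_submodule_of_iSupIndep_of_iSup_eq_top
      A.independent_maxGenEigenspace (iSup_maxGenEigenspace_eq_top A)
  have hN : {μ | A.maxGenEigenspace μ ≠ ⊥}.Finite :=
    WellFoundedGT.finite_ne_bot_of_iSupIndep hInternal.submodule_iSupIndep
  refine ⟨hN.toFinset, ?_, ?_⟩
  · intro μ hμ
    rw [Set.Finite.mem_toFinset, Set.mem_setOf_eq] at hμ
    by_contra hne
    apply hμ
    have : A.HasUnifEigenvalue μ ⊤ → A.HasEigenvalue μ := fun hh =>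
      hh.lt one_pos
    by_contra h2
    exact hne (this h2)
  · intro i j
    have hA := fun μ => mapsTo_maxGenEigenspace_of_comm (Commute.refl A) μ
    have hC := fun μ => mapsTo_maxGenEigenspace_of_comm h μ
    have hAC := fun μ => mapsTo_maxGenEigenspace_of_comm
      (((Commute.refl A).pow_right i).mul_right (h.pow_right j)) μ
    rw [LinearMap.trace_eq_sum_trace_restrict' hInternal hN hAC]
    apply Finset.sum_congr rfl
    intro μ _
    have hnil := A.isNilpotent_restrict_maxGenEigenspace_sub_algebraMap μ
    set a : Module.End K _ := LinearMap.restrict A (hA μ) with ha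
    set c : Module.End K _ := LinearMap.restrict C (hC μ) with hc
    have hcomm : Commute a c := by
      ext x; exact congrArg (fun T => T x.1) h.eq
    have e1 : (A ^ i * C ^ j).restrict (hAC μ) = c ^ j * a ^ i := by
      rw [(hcomm.pow_pow i j).eq.symm]
      have ea : ∀ (i : ℕ) x, ((a ^ i) x : M) = (A ^ i) x := by
        intro i
        induction i with
        | zero => intro x; rfl
        | succ i ih => intro x; rw [pow_succ, pow_succ]; exact ih (a x)
      have ec : ∀ (i : ℕ) x, ((c ^ i) x : M) = (C ^ i) x := by
        intro i
        induction i with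
        | zero => intro x; rfl
        | succ i ih => intro x; rw [pow_succ, pow_succ]; exact ih (c x)
      apply LinearMap.ext; intro x; apply Subtype.ext
      rw [Module.End.mul_apply, ea, ec]; rfl
    rw [e1]
    have hnil' : IsNilpotent (a ^ i - algebraMap K _ (μ ^ i)) := by
      rw [map_pow]
      rw [← (Algebra.commute_algebraMap_right μ a).mul_geom_sum₂ i]
      have hn : IsNilpotent (a - algebraMap K _ μ) := by
        exact hnil
      apply Commute.isNilpotent_mul_right _ hn
      apply Commute.sum_right
      intro k _
      have c1 : Commute (a - algebraMap K _ μ) a :=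
        (Commute.refl a).sub_left (Algebra.commute_algebraMap_left μ a)
      exact (c1.pow_right _).mul_right ((Algebra.commute_algebraMap_right μ _).pow_right _)
    exact LinearMap.trace_comp_eq_mul_of_commute_of_isNilpotent (μ^i) ((hcomm.pow_pow i j).symm) hnil'

lemma trace_joint {M : Type*} [AddCommGroup M] [Module K M] [FiniteDimensional K M]
    (A B : Module.End K M) (h : Commute A B) :
    ∃ s : Multiset (K × K), (∀ p ∈ s, A.HasEigenvalue p.1 ∧ B.HasEigenvalue p.2) ∧
      ∀ i j : ℕ, LinearMap.trace K M (A ^ i * B ^ j) = (s.map (fun p => p.1 ^ i * p.2 ^ j)).sum := by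
  classical
  obtain ⟨F, hF, hT⟩ := trace_gen A B h
  let E : ∀ μ, Module.End K (A.maxGenEigenspace μ) := fun μ => B.restrict (mapsTo_maxGenEigenspace_of_comm h μ)
  have h2 := fun μ => trace_gen (E μ) 1 (Commute.one_right _)
  choose G hG hGT using h2
  refine ⟨F.val.bind (fun μ => (G μ).val.bind (fun ν => Multiset.replicate
    (Module.finrank K ((E μ).maxGenEigenspace ν)) (μ, ν))), ?_, ?_⟩
  · rintro ⟨μ, ν⟩ hp
    rw [Multiset.mem_bind] at hp
    obtain ⟨μ', hμ', hp⟩ := hp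
    rw [Multiset.mem_bind] at hp
    obtain ⟨ν', hν', hp⟩ := hp
    have := Multiset.eq_of_mem_replicate hp
    simp only [Prod.mk.injEq] at this
    obtain ⟨rfl, rfl⟩ := this
    refine ⟨hF _ hμ', ?_⟩
    obtain ⟨v, hv⟩ := (hG _ _ hν').exists_hasEigenvector
    rw [hasEigenvector_iff, mem_eigenspace_iff] at hv
    refine hasEigenvalue_of_hasEigenvector (x := v.1) ?_
    rw [hasEigenvector_iff, mem_eigenspace_iff]
    exact ⟨congrArg Subtype.val hv.1, fun h0 => hv.2 (Subtype.ext h0)⟩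
  · intro i j
    rw [hT i j, Multiset.map_bind, Multiset.sum_bind, Finset.sum]
    congr 1
    apply Multiset.map_congr rfl
    intro μ _
    rw [Multiset.map_bind, Multiset.sum_bind]
    have := hGT μ j 1
    rw [one_pow, mul_one] at this
    rw [show (B.restrict (mapsTo_maxGenEigenspace_of_comm h μ)) = E μ from rfl]
    rw [this, Finset.mul_sum, Finset.sum]
    congr 1
    apply Multiset.map_congr rfl
    intro ν _
    rw [Multiset.map_replicate, Multiset.sum_replicate, nsmul_eq_mul]
    have e : LinearMap.restrict (1 : Module.End K _) (mapsTo_maxGenEigenspace_of_comm (Commute.one_right (E μ)) ν) = 1 := rfl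
    rw [e, one_pow, LinearMap.trace_one]
    ring
end trace
end SD

namespace SD
set_option linter.all false
open TensorProduct Coalgebra HopfAlgebra

section pos
variable {K : Type*} [Field K] [IsAlgClosed K] [CharZero K]
open Module.End

lemma pow_eigen {M : Type*} [AddCommGroup M] [Module K M] 
    {U : Module.End K M} {α : K} (h : U.HasEigenvalue α) {N : ℕ} {c : K} (hU : U ^ N = c • 1) : α ^ N = c := by
  obtain ⟨v, hv⟩ := h.exists_hasEigenvector
  have := hv.pow_apply N
  rw [hU] at this
  have h2 : (c - α ^ N) • v = 0 := by rw [sub_smul, ← this]; simp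
  rcases smul_eq_zero.1 h2 with h3 | h3
  · exact (sub_eq_zero.1 h3).symm
  · exact absurd h3 hv.2

lemma trace_pos (φ : algebraicClosure ℚ K →+* ℂ) {M : Type*} [AddCommGroup M] [Module K M]
    [FiniteDimensional K M] (U : Module.End K M) (N : ℕ) (hN : 0 < N) (hU : U ^ N = 1) :
    ∃ (x : algebraicClosure ℚ K) (r : ℝ), 0 ≤ r ∧
      (x : K) = LinearMap.trace K M U * LinearMap.trace K M (U ^ (N - 1)) ∧ φ x = r ∧
      (LinearMap.trace K M (U ^ (N - 1)) ≠ 0 → 0 < r) := by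
  obtain ⟨s, hs, hT⟩ := trace_joint U 1 (Commute.one_right _)
  have hs' : ∀ a ∈ s.map Prod.fst, a ∈ algebraicClosure ℚ K := by
    intro a ha
    obtain ⟨p, hp, rfl⟩ := Multiset.mem_map.1 ha
    have h1 : p.1 ^ N = 1 := pow_eigen (hs p hp).1 (by rw [hU, one_smul])
    rw [mem_algebraicClosure_iff]
    apply IsAlgebraic.of_pow hN
    rw [h1]; exact isAlgebraic_one
  obtain ⟨s', hs'2⟩ : ∃ s' : Multiset (algebraicClosure ℚ K), s'.map (algebraMap (algebraicClosure ℚ K) K) = s.map Prod.fst := by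
    refine ⟨(s.map Prod.fst).attach.map (fun a => ⟨a.1, hs' a.1 a.2⟩), ?_⟩
    rw [Multiset.map_map]
    exact Multiset.attach_map_val _
  have tk : ∀ k, LinearMap.trace K M (U ^ k) =
      (((s'.map (fun x => x ^ k)).sum : algebraicClosure ℚ K) : K) := by
    intro k
    have h1 := hT k 0
    simp only [pow_zero, mul_one] at h1
    have h2 : s.map (fun p => p.1 ^ k) = (s.map Prod.fst).map (fun a => a ^ k) := by
      rw [Multiset.map_map]; rfl
    rw [h1, h2, ← hs'2, Multiset.map_map]
    have h3 := map_multiset_sum (algebraMap (algebraicClosure ℚ K) K) (s'.map (fun x => x ^ k))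
    rw [Multiset.map_map] at h3
    refine Eq.trans ?_ h3.symm
    congr 1
  have hroot : ∀ x ∈ s', x ^ N = 1 := by
    intro x hx
    have : (x : K) ∈ s.map Prod.fst := by rw [← hs'2]; exact Multiset.mem_map_of_mem _ hx
    obtain ⟨p, hp, hpx⟩ := Multiset.mem_map.1 this
    have h1 : p.1 ^ N = 1 := pow_eigen (hs p hp).1 (by rw [hU, one_smul])
    apply Subtype.ext
    rw [hpx] at h1
    exact h1
  set z : ℂ := φ s'.sum with hz
  have hconj : φ ((s'.map (fun x => x ^ (N-1))).sum) = (starRingEnd ℂ) z := by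
    rw [hz, map_multiset_sum, map_multiset_sum, map_multiset_sum]
    rw [Multiset.map_map, Multiset.map_map]
    congr 1
    apply Multiset.map_congr rfl
    intro x hx
    have h1 : (φ x) ^ N = 1 := by rw [← map_pow, hroot x hx, map_one]
    have h2 : ‖φ x‖ = 1 := by
      have : ‖φ x‖ ^ N = 1 := by rw [← norm_pow, h1, norm_one]
      exact (pow_eq_one_iff_of_nonneg (norm_nonneg _) hN.ne').1 this
    have h3 : φ x ≠ 0 := by intro h0; rw [h0, norm_zero] at h2; exact zero_ne_one h2
    simp only [Function.comp, map_pow]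
    apply mul_left_cancel₀ h3
    rw [← pow_succ', Nat.sub_add_cancel hN, h1, Complex.mul_conj, Complex.normSq_eq_norm_sq, h2]
    simp
  have t1 := tk 1
  simp only [pow_one] at t1
  rw [Multiset.map_id'] at t1
  refine ⟨s'.sum * (s'.map (fun x => x ^ (N-1))).sum, Complex.normSq z, Complex.normSq_nonneg _,
    ?_, ?_, ?_⟩
  · rw [t1, tk (N-1)]; rfl
  · rw [map_mul, hconj, ← hz, Complex.mul_conj]
  · intro h
    rw [Complex.normSq_pos]
    intro h0
    rw [h0, map_zero] at hconj
    apply h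
    rw [tk (N-1), (map_eq_zero φ).1 hconj]; rfl

lemma sum_ne_zero {ι : Type*} [Fintype ι] [Nonempty ι] {M : ι → Type*} [∀ i, AddCommGroup (M i)]
    [∀ i, Module K (M i)] [∀ i, FiniteDimensional K (M i)] (u v : ∀ i, Module.End K (M i))
    (huv : ∀ i, u i * v i = 1) (N : ℕ) (hN : 0 < N) (c : ι → K) (hc : ∀ i, u i ^ N = c i • 1)
    (h1 : ∀ i, LinearMap.trace K _ (v i) = 1) :
    ∑ i, LinearMap.trace K _ (u i) ≠ 0 := by
  haveI halg : Algebra.IsAlgebraic ℚ (algebraicClosure ℚ K) := by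
    convert algebraicClosure.isAlgebraic ℚ K
    · rfl
    · exact Subsingleton.elim _ _
  have φ : algebraicClosure ℚ K →+* ℂ := (IsAlgClosed.lift (R := ℚ) : algebraicClosure ℚ K →ₐ[ℚ] ℂ).toRingHom
  have key : ∀ i, ∃ (x : algebraicClosure ℚ K) (r : ℝ), 0 < r ∧
      (x : K) = LinearMap.trace K _ (u i) ∧ φ x = r := by
    intro i
    obtain ⟨r, hr⟩ := IsAlgClosed.exists_pow_nat_eq (c i) hN
    have hvu : v i * u i = 1 := mul_eq_one_comm.1 (huv i)
    have hcomm : Commute (u i) (v i) := by rw [Commute, SemiconjBy, huv, hvu]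
    have hr0 : r ≠ 0 := by
      rintro rfl
      rw [zero_pow hN.ne'] at hr
      have h2 : (u i * v i) ^ N = 0 := by rw [hcomm.mul_pow, hc, ← hr]; simp
      rw [huv, one_pow] at h2
      have := h1 i
      rw [← one_mul (v i), h2] at this
      simp at this
    obtain ⟨x, t, ht, hx, hφ, hpos⟩ := trace_pos φ (r⁻¹ • u i) N hN (by
      rw [smul_pow, hc, ← hr, smul_smul, ← mul_pow, inv_mul_cancel₀ hr0, one_pow, one_smul])
    have e2 : (r⁻¹ • u i) ^ (N-1) = r • v i := by
      have e3 : (r⁻¹ • u i) ^ (N-1) * (r⁻¹ • u i) = 1 := by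
        rw [← pow_succ, Nat.sub_add_cancel hN, smul_pow, hc, ← hr, smul_smul, ← mul_pow,
          inv_mul_cancel₀ hr0, one_pow, one_smul]
      have e4 : (r⁻¹ • u i) * (r • v i) = 1 := by
        rw [smul_mul_smul_comm, inv_mul_cancel₀ hr0, huv, one_smul]
      exact left_inv_eq_right_inv e3 e4
    rw [e2, map_smul, map_smul, h1, smul_eq_mul, smul_eq_mul, mul_one] at hx
    rw [e2, map_smul, h1, smul_eq_mul, mul_one] at hpos
    refine ⟨x, t, hpos hr0, ?_, hφ⟩
    rw [hx]; field_simp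
  choose x r hr hx hφ using key
  intro h0
  have h2 : ∑ i, x i = 0 := by
    apply Subtype.ext
    have : (algebraMap (algebraicClosure ℚ K) K) (∑ i, x i) = ∑ i, LinearMap.trace K _ (u i) := by
      rw [map_sum]; exact Finset.sum_congr rfl (fun i _ => hx i)
    exact this.trans h0
  have h3 := congrArg φ h2
  rw [map_sum, map_zero] at h3
  simp only [hφ] at h3
  rw [← Complex.ofReal_sum] at h3
  have h4 : ∑ i, r i = 0 := by exact_mod_cast h3
  have h5 : 0 < ∑ i, r i := Finset.sum_pos (fun i _ => hr i) Finset.univ_nonempty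
  exact h5.ne' h4
end pos
end SD

namespace SD
set_option linter.all false
open TensorProduct Coalgebra HopfAlgebra

section wedder
variable {K : Type*} [Field K]

lemma trace_LR {n : ℕ} {d : Fin n → ℕ} (a b : Π i, Matrix (Fin (d i)) (Fin (d i)) K) :
    LinearMap.trace K (Π i, Matrix (Fin (d i)) (Fin (d i)) K)
      (LinearMap.mulLeft K a ∘ₗ LinearMap.mulRight K b) =
    ∑ i, (a i).trace * (b i).trace := by
  classical
  let B := Pi.basis (fun i => Matrix.stdBasis K (Fin (d i)) (Fin (d i)))
  rw [LinearMap.trace_eq_matrix_trace K B, Matrix.trace]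
  rw [← Finset.univ_sigma_univ, Finset.sum_sigma]
  apply Finset.sum_congr rfl; intro i _
  rw [← Finset.univ_product_univ, Finset.sum_product, Matrix.trace, Matrix.trace, Finset.sum_mul_sum]
  apply Finset.sum_congr rfl; intro j _
  apply Finset.sum_congr rfl; intro k _
  rw [Matrix.diag_apply, LinearMap.toMatrix_apply]
  simp only [B, Pi.basis_repr, Pi.basis_apply, Matrix.stdBasis_eq_single, LinearMap.comp_apply,
    LinearMap.mulLeft_apply, LinearMap.mulRight_apply, Pi.mul_apply, Pi.single_eq_same]
  have : ∀ M : Matrix (Fin (d i)) (Fin (d i)) K, (Matrix.stdBasis K (Fin (d i)) (Fin (d i))).repr M (j, k) = M j k := by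
    intro M
    simp [Matrix.stdBasis, Module.Basis.map_repr]
  rw [this]
  simp [Matrix.mul_apply, Matrix.single, Finset.sum_ite_eq]
  simp [ite_and, Finset.sum_ite_eq, Finset.sum_mul]

lemma functional_matrix {n : ℕ} {d : Fin n → ℕ} (f : (Π i, Matrix (Fin (d i)) (Fin (d i)) K) →ₗ[K] K) :
    ∃ u : Π i, Matrix (Fin (d i)) (Fin (d i)) K, ∀ y, f y = ∑ i, (u i * y i).trace := by
  classical
  refine ⟨fun i => Matrix.of (fun k j => f (Pi.single i (Matrix.single j k 1))), ?_⟩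
  intro y
  conv_lhs => rw [← Finset.univ_sum_single y, map_sum]
  apply Finset.sum_congr rfl; intro i _
  conv_lhs => rw [Matrix.matrix_eq_sum_single (y i)]
  have h : ∀ M, f (Pi.single i M) = (f ∘ₗ LinearMap.single K _ i) M := fun M => rfl
  rw [h]
  simp only [map_sum, Matrix.trace, Matrix.diag_apply, Matrix.mul_apply, Matrix.of_apply, h]
  rw [Finset.sum_comm]
  apply Finset.sum_congr rfl; intro j _
  apply Finset.sum_congr rfl; intro k _
  rw [mul_comm, ← smul_eq_mul, ← map_smul]
  congr 1
  simp [Matrix.smul_single]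

variable [IsAlgClosed K] [CharZero K]
variable {H : Type*} [Ring H] [HopfAlgebra K H] [FiniteDimensional K H] [IsSemisimpleRing H]

lemma lam_one_ne_zero {Λ : H} (I : Intg K Λ) : lam K H 1 ≠ 0 := by
  classical
  obtain ⟨n, d, hd, ⟨e⟩⟩ := IsSemisimpleRing.exists_algEquiv_pi_matrix_of_isAlgClosed K H
  obtain ⟨u, hu⟩ := functional_matrix (lam K H ∘ₗ e.symm.toLinearMap)
  have hu' : ∀ x : H, lam K H x = ∑ i, (u i * e x i).trace := by
    intro x; rw [← hu (e x)]; simp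
  let w := e.symm u
  have hw : ∀ i, e w i = u i := fun i => by simp [w]
  let τ : H → K := fun x => ∑ i, (e x i).trace
  have τc : ∀ x y, τ (x * y) = τ (y * x) := by
    intro x y; simp only [τ, map_mul, Pi.mul_apply]
    exact Finset.sum_congr rfl (fun i _ => Matrix.trace_mul_comm _ _)
  have hτ : ∀ x, lam K H x = τ (w * x) := by
    intro x; rw [hu']; simp only [τ, map_mul, Pi.mul_apply, hw]
  have winj : Function.Injective (LinearMap.mulLeft K w) := by
    rw [injective_iff_map_eq_zero]
    intro x hx
    rw [LinearMap.mulLeft_apply] at hx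
    apply lam_nondeg I
    intro y
    rw [hτ, ← mul_assoc, hx, zero_mul]; simp [τ]
  obtain ⟨v, hv⟩ := LinearMap.surjective_of_injective winj 1
  rw [LinearMap.mulLeft_apply] at hv
  have hv2 : v * w = 1 := by
    apply winj
    simp only [LinearMap.mulLeft_apply]
    rw [← mul_assoc, hv, one_mul, mul_one]
  have τnd : ∀ x, (∀ y, τ (x * y) = 0) → x = 0 := by
    intro x hx
    have : v * x = 0 := by
      apply lam_nondeg I
      intro y
      rw [hτ, ← mul_assoc, ← mul_assoc, hv, one_mul, hx]
    rw [← one_mul x, ← hv, mul_assoc, this, mul_zero]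
  have τsub : ∀ x y, τ (x - y) = τ x - τ y := by
    intro x y; simp [τ]
  have hS : ∀ x, w * x = S2 K H x * w := by
    intro x
    rw [← sub_eq_zero]
    apply τnd
    intro y
    have := nakayama I x y
    rw [hτ, hτ, ← mul_assoc, ← mul_assoc, τc _ (S2 K H x), ← mul_assoc] at this
    rw [sub_mul, τsub, this, sub_self]
  have hS2 : ∀ x, S2 K H x = w * x * v := by
    intro x; rw [hS, mul_assoc, hv, mul_one]
  have hlam : ∀ h, lam K H h = ∑ i, (e h i * u i).trace * (e v i).trace := by
    intro h
    rw [lam_apply]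
    have h1 : LinearMap.mulLeft K h ∘ₗ S2 K H = LinearMap.mulLeft K (h * w) ∘ₗ LinearMap.mulRight K v := by
      ext x; simp [hS2, mul_assoc]
    have h2 : e.toLinearEquiv.conj (LinearMap.mulLeft K (h * w) ∘ₗ LinearMap.mulRight K v) =
        LinearMap.mulLeft K (e (h * w)) ∘ₗ LinearMap.mulRight K (e v) := by
      apply LinearMap.ext; intro x
      simp [LinearEquiv.conj_apply]
    rw [h1, ← LinearMap.trace_conj' _ e.toLinearEquiv, h2, trace_LR]
    simp [hw]
  have huv : ∀ i, u i * e v i = 1 := by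
    intro i; rw [← hw i, ← Pi.mul_apply, ← map_mul, hv]; simp
  have hvu : ∀ i, e v i * u i = 1 := by
    intro i; rw [← hw i, ← Pi.mul_apply, ← map_mul, hv2]; simp
  have trv : ∀ i, (e v i).trace = 1 := by
    intro i
    let h := e.symm (Pi.single i (e v i))
    have h1 := hlam h
    rw [hu' h] at h1
    have eh : e h = Pi.single i (e v i) := by simp [h]
    rw [eh] at h1
    rw [Finset.sum_eq_single i, Finset.sum_eq_single i] at h1
    · rw [Pi.single_eq_same, huv, hvu, Matrix.trace_one] at h1
      have : ((Fintype.card (Fin (d i)) : ℕ) : K) ≠ 0 := by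
        rw [Fintype.card_fin]
        haveI := hd i
        exact_mod_cast NeZero.ne (d i)
      exact (mul_right_eq_self₀.1 h1.symm).resolve_right this
    · intro j _ hj; rw [Pi.single_eq_of_ne hj]; simp
    · simp
    · intro j _ hj; rw [Pi.single_eq_of_ne hj]; simp
    · simp
  obtain ⟨m, hm, hm2⟩ := S4_pow I
  have hpow : ∀ k : ℕ, ∀ x, ((S2 K H) ^ k) x * w ^ k = w ^ k * x := by
    intro k
    induction k with
    | zero => intro x; simp
    | succ k ih =>
      intro x
      rw [pow_succ, Module.End.mul_apply, pow_succ, ← mul_assoc, ih, mul_assoc, ← hS, mul_assoc]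
  have hcent : ∀ x, x * w ^ (2*m) = w ^ (2*m) * x := by
    intro x; rw [← hpow (2*m) x, hm2]
  have hsc : ∀ i, ∃ c : K, (u i) ^ (2*m) = c • 1 := by
    intro i
    have : ∀ M, Commute ((u i) ^ (2*m)) M := by
      intro M
      have h1 := congrArg (fun z => e z i) (hcent (e.symm (Pi.single i M)))
      simp only [map_mul, Pi.mul_apply, AlgEquiv.apply_symm_apply, Pi.single_eq_same, map_pow,
        Pi.pow_apply, hw] at h1
      exact h1.symm
    obtain ⟨c, hc⟩ := Matrix.mem_range_scalar_of_commute_single (M := (u i) ^ (2*m)) (fun a b _ => (this _).symm)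
    refine ⟨c, ?_⟩
    rw [← hc]; simp [Matrix.smul_one_eq_diagonal]
  choose c hc using hsc
  have hne : Nonempty (Fin n) := by
    by_contra hne
    rw [not_nonempty_iff] at hne
    have h1 : lam K H Λ = 0 := by rw [hu']; simp
    rw [I.lam] at h1
    exact one_ne_zero h1
  have := sum_ne_zero (K := K) (ι := Fin n) (M := fun i => Fin (d i) → K)
    (fun i => Matrix.toLinAlgEquiv' (u i)) (fun i => Matrix.toLinAlgEquiv' (e v i))
    (fun i => by rw [← map_mul, huv, map_one]) (2*m) (by omega) c
    (fun i => by rw [← map_pow, hc, map_smul, map_one])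
    (fun i => by
      have := Matrix.trace_toLin'_eq (e v i)
      exact this.trans (trv i))
  rw [hu' 1]
  convert this using 2
  rename_i i _
  rw [map_one, Pi.one_apply, mul_one]
  exact (Matrix.trace_toLin'_eq (u i)).symm
end wedder
end SD

namespace SD
set_option linter.all false
open TensorProduct Coalgebra HopfAlgebra

section D
variable {K : Type*} [Field K]

lemma det_lT {A B : Type*} [AddCommGroup A] [Module K A] [FiniteDimensional K A]
    [AddCommGroup B] [Module K B] [FiniteDimensional K B] (X : B →ₗ[K] B) :
    LinearMap.det (LinearMap.lTensor A X) = LinearMap.det X ^ Module.finrank K A := by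
  classical
  let b := Module.finBasis K A
  let c := Module.finBasis K B
  rw [← LinearMap.det_toMatrix (b.tensorProduct c), LinearMap.lTensor, TensorProduct.toMatrix_map,
    Matrix.det_kronecker]
  simp

lemma det_rT {A B : Type*} [AddCommGroup A] [Module K A] [FiniteDimensional K A]
    [AddCommGroup B] [Module K B] [FiniteDimensional K B] (X : A →ₗ[K] A) :
    LinearMap.det (LinearMap.rTensor B X) = LinearMap.det X ^ Module.finrank K B := by
  classical
  let b := Module.finBasis K A
  let c := Module.finBasis K B
  rw [← LinearMap.det_toMatrix (b.tensorProduct c), LinearMap.rTensor, TensorProduct.toMatrix_map,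
    Matrix.det_kronecker]
  simp

variable {H : Type*} [AddCommGroup H] [Module K H] [FiniteDimensional K H]
  {W : Type*} [AddCommGroup W] [Module K W] [FiniteDimensional K W]

/-- action of an operator on first and third factors -/
noncomputable def X13 (X : H ⊗[K] W →ₗ[K] H ⊗[K] W) : H ⊗[K] (H ⊗[K] W) →ₗ[K] H ⊗[K] (H ⊗[K] W) :=
  (TensorProduct.leftComm K H H W).toLinearMap ∘ₗ LinearMap.lTensor H X ∘ₗ
    (TensorProduct.leftComm K H H W).toLinearMap

/-- action of an operator on first and second factors -/
noncomputable def Y12 (W : Type*) [AddCommGroup W] [Module K W] (Y : H ⊗[K] H →ₗ[K] H ⊗[K] H) : H ⊗[K] (H ⊗[K] W) →ₗ[K] H ⊗[K] (H ⊗[K] W) :=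
  (TensorProduct.assoc K H H W).toLinearMap ∘ₗ LinearMap.rTensor W Y ∘ₗ
    (TensorProduct.assoc K H H W).symm.toLinearMap

lemma det_X13 (X : H ⊗[K] W →ₗ[K] H ⊗[K] W) :
    LinearMap.det (X13 X) = LinearMap.det X ^ Module.finrank K H := by
  have := LinearMap.det_conj (LinearMap.lTensor H X) (TensorProduct.leftComm K H H W)
  rw [← det_lT, ← this]
  congr 1
  

lemma det_Y12 (Y : H ⊗[K] H →ₗ[K] H ⊗[K] H) :
    LinearMap.det (Y12 W Y) = LinearMap.det Y ^ Module.finrank K W := by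
  rw [← det_rT]
  exact LinearMap.det_conj (LinearMap.rTensor W Y) (TensorProduct.assoc K H H W)

lemma det_pent (X : H ⊗[K] W →ₗ[K] H ⊗[K] W) (Y : H ⊗[K] H →ₗ[K] H ⊗[K] H)
    (hX : LinearMap.det X ≠ 0) (hY : LinearMap.det Y ≠ 0)
    (h : LinearMap.lTensor H X ∘ₗ Y12 W Y = Y12 W Y ∘ₗ X13 X ∘ₗ LinearMap.lTensor H X) :
    LinearMap.det X ^ Module.finrank K H = 1 := by
  have h2 := congrArg LinearMap.det h
  simp only [LinearMap.det_comp, det_X13, det_Y12, det_lT] at h2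
  have a := pow_ne_zero (Module.finrank K H) hX
  have b := pow_ne_zero (Module.finrank K W) hY
  rw [mul_comm] at h2
  have h3 := mul_left_cancel₀ b h2
  exact mul_right_cancel₀ a (by rw [← h3, one_mul])

lemma det_pent' (X : H ⊗[K] W →ₗ[K] H ⊗[K] W) (Y : H ⊗[K] H →ₗ[K] H ⊗[K] H)
    (hX : LinearMap.det X ≠ 0) (hY : LinearMap.det Y ≠ 0)
    (h : Y12 W Y ∘ₗ LinearMap.lTensor H X = LinearMap.lTensor H X ∘ₗ X13 X ∘ₗ Y12 W Y) :
    LinearMap.det X ^ Module.finrank K H = 1 := by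
  have h2 := congrArg LinearMap.det h
  simp only [LinearMap.det_comp, det_X13, det_Y12, det_lT] at h2
  have a := pow_ne_zero (Module.finrank K H) hX
  have b := pow_ne_zero (Module.finrank K W) hY
  rw [mul_comm] at h2
  have h3 := mul_left_cancel₀ a h2
  exact mul_right_cancel₀ b (by rw [← h3, one_mul])

end D

section ops
variable {K : Type*} [Field K]
variable {H : Type*} [Ring H] [HopfAlgebra K H] [FiniteDimensional K H]
variable {W M : Type*} [AddCommGroup W] [Module K W] [AddCommGroup M] [Module K M]
local notation "S" => antipode K (A := H)

lemma cA (δ : W →ₗ[K] W ⊗[K] H)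
    (hδ : ∀ w, TensorProduct.assoc K W H H (LinearMap.rTensor H δ (δ w)) =
      LinearMap.lTensor W (comul (R := K)) (δ w))
    (w : W) (F : W → H → H → M)
    (h1 : ∀ c, Bil K (fun a b => F a b c) := by (intros; constructor <;> intros <;> simp [sw, tsum, add_mul, mul_add, tmul_add, add_tmul, ← smul_tmul', add_smul, Finset.sum_add_distrib, Finset.smul_sum, Finset.mul_sum, Finset.sum_mul, smul_smul, mul_comm, mul_left_comm, mul_assoc]))
    (h2 : ∀ a, Bil K (fun b c => F a b c) := by (intros; constructor <;> intros <;> simp [sw, tsum, add_mul, mul_add, tmul_add, add_tmul, ← smul_tmul', add_smul, Finset.sum_add_distrib, Finset.smul_sum, Finset.mul_sum, Finset.sum_mul, smul_smul, mul_comm, mul_left_comm, mul_assoc])) :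
    tsum (δ w) (fun a b => tsum (δ a) (fun a' c => F a' c b)) =
      tsum (δ w) (fun a b => sw K b (fun c d => F a c d)) := co_assoc δ hδ w F h1 h2

lemma cE (δ : W →ₗ[K] W ⊗[K] H)
    (hδ : ∀ w, TensorProduct.rid K W (LinearMap.lTensor W (counit (R := K)) (δ w)) = w)
    (w : W) (f : W → M)
    (hf : Lin K f := by (intros; constructor <;> intros <;> simp [sw, tsum, add_mul, mul_add, tmul_add, add_tmul, ← smul_tmul', add_smul, Finset.sum_add_distrib, Finset.smul_sum, Finset.mul_sum, Finset.sum_mul, smul_smul, mul_comm, mul_left_comm, mul_assoc])) :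
    tsum (δ w) (fun a b => counit (R := K) b • f a) = f w := by
  have hB : Bil K (fun (a : W) (b : H) => counit (R := K) b • f a) :=
    ⟨by simp [hf.a], by simp [add_smul], fun c a b => by rw [hf.s, smul_comm], by simp [mul_smul]⟩
  rw [tsum_eq _ hB]
  have : ∀ t : W ⊗[K] H, tl _ hB t =
      hf.mk (TensorProduct.rid K W (LinearMap.lTensor W (counit (R := K)) t)) := by
    intro t
    induction t with
    | zero => simp only [map_zero]
    | add x y hx hy => simp only [hx, hy, map_add]
    | tmul c d => simp
  rw [this, hδ]; simp

lemma tl_sw {A B : Type*} [AddCommGroup A] [Module K A] [AddCommGroup B] [Module K B]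
    (F : A → B → M) (hF : Bil K F) (x : H) (G : H → H → A) (G' : H → H → B) :
    tl F hF (sw K x (fun a b => G a b ⊗ₜ[K] G' a b)) = sw K x (fun a b => F (G a b) (G' a b)) := by
  rw [map_sw]; rfl

variable (ρ : H →ₐ[K] Module.End K W) (δ : W →ₗ[K] W ⊗[K] H) (φ : H →ₗ[K] H)

/-- `a ⊗ w ↦ a₁ ⊗ φ(a₂) w` -/
noncomputable def TA : H ⊗[K] W →ₗ[K] H ⊗[K] W :=
  tl (fun a w => sw K a (fun a1 a2 => a1 ⊗ₜ[K] ρ (φ a2) w)) (by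
    constructor <;> intros <;> simp [sw, tsum, tmul_add, add_tmul, ← smul_tmul', Finset.sum_add_distrib, Finset.smul_sum])

/-- `a ⊗ w ↦ a₂ ⊗ φ(a₁) w` -/
noncomputable def TB : H ⊗[K] W →ₗ[K] H ⊗[K] W :=
  tl (fun a w => sw K a (fun a1 a2 => a2 ⊗ₜ[K] ρ (φ a1) w)) (by
    constructor <;> intros <;> simp [sw, tsum, tmul_add, add_tmul, ← smul_tmul', Finset.sum_add_distrib, Finset.smul_sum])

/-- `a ⊗ w ↦ a φ(w₁) ⊗ w₀` -/
noncomputable def PA : H ⊗[K] W →ₗ[K] H ⊗[K] W :=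
  tl (fun a w => tsum (δ w) (fun w0 w1 => (a * φ w1) ⊗ₜ[K] w0)) (by
    constructor <;> intros <;> simp [tsum, tmul_add, add_tmul, add_mul, ← smul_tmul', Finset.sum_add_distrib, Finset.smul_sum])

/-- `a ⊗ w ↦ φ(w₁) a ⊗ w₀` -/
noncomputable def PB : H ⊗[K] W →ₗ[K] H ⊗[K] W :=
  tl (fun a w => tsum (δ w) (fun w0 w1 => (φ w1 * a) ⊗ₜ[K] w0)) (by
    constructor <;> intros <;> simp [tsum, tmul_add, add_tmul, mul_add, ← smul_tmul', Finset.sum_add_distrib, Finset.smul_sum])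

lemma TA_tmul (a : H) (w : W) : TA ρ φ (a ⊗ₜ w) = sw K a (fun a1 a2 => a1 ⊗ₜ[K] ρ (φ a2) w) := rfl
lemma TB_tmul (a : H) (w : W) : TB ρ φ (a ⊗ₜ w) = sw K a (fun a1 a2 => a2 ⊗ₜ[K] ρ (φ a1) w) := rfl
lemma PA_tmul (a : H) (w : W) : PA δ φ (a ⊗ₜ w) = tsum (δ w) (fun w0 w1 => (a * φ w1) ⊗ₜ[K] w0) := rfl
lemma PB_tmul (a : H) (w : W) : PB δ φ (a ⊗ₜ w) = tsum (δ w) (fun w0 w1 => (φ w1 * a) ⊗ₜ[K] w0) := rfl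

variable (S4 : ∀ z : H, S2 K H (S2 K H z) = z)

variable (K H) in
/-- inverse antipode -/
noncomputable def Sb : H →ₗ[K] H := antipode K ∘ₗ S2 K H

include S4 in
lemma S_Sb (z : H) : S (Sb K H z) = z := by
  have := S4 z
  simpa [Sb, S2_apply] using this
  
include S4 in
lemma Sb_S (z : H) : Sb K H (S z) = z := by
  have := S4 z
  simpa [Sb, S2_apply] using this

include S4 in
lemma S_inj4 : Function.Injective (antipode K (A := H)) := 
  Function.LeftInverse.injective (Sb_S S4)

include S4 in
lemma swBr (x : H) (f : H → M) (hf : Lin K f := by (intros; constructor <;> intros <;> simp [sw, tsum, add_mul, mul_add, tmul_add, add_tmul, ← smul_tmul', add_smul, Finset.sum_add_distrib, Finset.smul_sum, Finset.mul_sum, Finset.sum_mul, smul_smul, mul_comm, mul_left_comm, mul_assoc])) :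
    sw K x (fun a b => f (b * Sb K H a)) = counit (R := K) x • f 1 := by
  have h1 : sw K x (fun a b => b * Sb K H a) = counit (R := K) x • 1 := by
    apply S_inj4 S4
    rw [map_sw]
    simp only [antipode_mul, S_Sb S4, map_smul, antipode_one]
    exact swSr x (fun z => z)
  have := congrArg hf.mk h1
  rw [map_sw, map_smul] at this
  exact this

include S4 in
lemma swBl (x : H) (f : H → M) (hf : Lin K f := by (intros; constructor <;> intros <;> simp [sw, tsum, add_mul, mul_add, tmul_add, add_tmul, ← smul_tmul', add_smul, Finset.sum_add_distrib, Finset.smul_sum, Finset.mul_sum, Finset.sum_mul, smul_smul, mul_comm, mul_left_comm, mul_assoc])) :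
    sw K x (fun a b => f (Sb K H b * a)) = counit (R := K) x • f 1 := by
  have h1 : sw K x (fun a b => Sb K H b * a) = counit (R := K) x • 1 := by
    apply S_inj4 S4
    rw [map_sw]
    simp only [antipode_mul, S_Sb S4, map_smul, antipode_one]
    exact swSl x (fun z => z)
  have := congrArg hf.mk h1
  rw [map_sw, map_smul] at this
  exact this

lemma TA_inv : TA ρ LinearMap.id ∘ₗ TA ρ (antipode K) = LinearMap.id := by
  apply TensorProduct.ext'
  intro a w
  rw [LinearMap.comp_apply, TA_tmul, map_sw]
  simp only [TA_tmul, LinearMap.id_apply]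
  rw [swA a (fun p q r => p ⊗ₜ[K] ρ q (ρ (S r) w))]
  have : ∀ p r : H, sw K r (fun q t => p ⊗ₜ[K] ρ q (ρ (S t) w)) = counit (R := K) r • (p ⊗ₜ[K] w) := by
    intro p r
    have := swSr (K := K) r (fun z => p ⊗ₜ[K] ρ z w)
    simpa using this
  simp only [this]
  exact swEr a (fun p => p ⊗ₜ[K] w)

include S4 in
lemma TB_inv : TB ρ LinearMap.id ∘ₗ TB ρ (Sb K H) = LinearMap.id := by
  apply TensorProduct.ext'
  intro a w
  rw [LinearMap.comp_apply, TB_tmul, map_sw]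
  simp only [TB_tmul, LinearMap.id_apply]
  rw [← swA a (fun p q r => r ⊗ₜ[K] ρ q (ρ (Sb K H p) w))]
  have : ∀ p r : H, sw K p (fun q t => r ⊗ₜ[K] ρ t (ρ (Sb K H q) w)) = counit (R := K) p • (r ⊗ₜ[K] w) := by
    intro p r
    have := swBr S4 (K := K) p (fun z => r ⊗ₜ[K] ρ z w)
    simpa using this
  simp only [this]
  exact swEl a (fun p => p ⊗ₜ[K] w)

variable (hδ : ∀ w, TensorProduct.assoc K W H H (LinearMap.rTensor H δ (δ w)) =
      LinearMap.lTensor W (comul (R := K)) (δ w))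
  (hε : ∀ w, TensorProduct.rid K W (LinearMap.lTensor W (counit (R := K)) (δ w)) = w)

include S4 hδ hε in
lemma PA_inv : PA δ LinearMap.id ∘ₗ PA δ (Sb K H) = LinearMap.id := by
  apply TensorProduct.ext'
  intro a w
  rw [LinearMap.comp_apply, PA_tmul, map_tsum]
  simp only [PA_tmul, LinearMap.id_apply]
  rw [cA δ hδ w (fun p q r => (a * Sb K H r * q) ⊗ₜ[K] p)]
  have : ∀ (p : W) (r : H), sw K r (fun q t => (a * Sb K H t * q) ⊗ₜ[K] p) = counit (R := K) r • (a ⊗ₜ[K] p) := by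
    intro p r
    have := swBl S4 (K := K) r (fun z => (a * z) ⊗ₜ[K] p)
    simpa [mul_assoc] using this
  simp only [this]
  exact cE δ hε w (fun p => a ⊗ₜ[K] p)

include hδ hε in
lemma PB_inv : PB δ LinearMap.id ∘ₗ PB δ (antipode K) = LinearMap.id := by
  apply TensorProduct.ext'
  intro a w
  rw [LinearMap.comp_apply, PB_tmul, map_tsum]
  simp only [PB_tmul, LinearMap.id_apply]
  rw [cA δ hδ w (fun p q r => (q * (S r * a)) ⊗ₜ[K] p)]
  have : ∀ (p : W) (r : H), sw K r (fun q t => (q * (S t * a)) ⊗ₜ[K] p) = counit (R := K) r • (a ⊗ₜ[K] p) := by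
    intro p r
    have := swSr (K := K) r (fun z => (z * a) ⊗ₜ[K] p)
    simpa [mul_assoc] using this
  simp only [this]
  exact cE δ hε w (fun p => a ⊗ₜ[K] p)

end ops
end SD

namespace SD
set_option linter.all false
open TensorProduct Coalgebra HopfAlgebra

section pent
variable {K : Type*} [Field K]
variable {H : Type*} [Ring H] [HopfAlgebra K H] [FiniteDimensional K H]
variable {W M : Type*} [AddCommGroup W] [Module K W] [AddCommGroup M] [Module K M] [FiniteDimensional K W]
variable (ρ : H →ₐ[K] Module.End K W) (δ : W →ₗ[K] W ⊗[K] H) 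

/-- auxiliary insertion map -/
noncomputable def ins2 (b : H) : H ⊗[K] W →ₗ[K] H ⊗[K] (H ⊗[K] W) :=
  (TensorProduct.leftComm K H H W).toLinearMap ∘ₗ TensorProduct.mk K H (H ⊗[K] W) b
lemma ins2_tmul (a b : H) (w : W) : ins2 (K := K) b (a ⊗ₜ[K] w) = a ⊗ₜ[K] (b ⊗ₜ[K] w) := rfl
/-- auxiliary insertion map -/
noncomputable def ins3 (w : W) : H ⊗[K] H →ₗ[K] H ⊗[K] (H ⊗[K] W) :=
  (TensorProduct.assoc K H H W).toLinearMap ∘ₗ (TensorProduct.mk K (H ⊗[K] H) W).flip w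
lemma ins3_tmul (a b : H) (w : W) : ins3 (K := K) w (a ⊗ₜ[K] b) = a ⊗ₜ[K] (b ⊗ₜ[K] w) := rfl

lemma X13_eq (X : H ⊗[K] W →ₗ[K] H ⊗[K] W) (a b : H) (w : W) :
  X13 X (a ⊗ₜ[K] (b ⊗ₜ[K] w)) = ins2 b (X (a ⊗ₜ w)) := rfl

lemma X23_eq (X : H ⊗[K] W →ₗ[K] H ⊗[K] W) (a b : H) (w : W) :
  LinearMap.lTensor H X (a ⊗ₜ[K] (b ⊗ₜ[K] w)) = (TensorProduct.mk K H (H ⊗[K] W) a) (X (b ⊗ₜ w)) := by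
  simp

lemma Y12_eq (Y : H ⊗[K] H →ₗ[K] H ⊗[K] H) (a b : H) (w : W) :
  Y12 W Y (a ⊗ₜ[K] (b ⊗ₜ[K] w)) = ins3 w (Y (a ⊗ₜ b)) := rfl

lemma det_ne_of_inv {A : Type*} [AddCommGroup A] [Module K A] {f g : A →ₗ[K] A}
    (h : f ∘ₗ g = LinearMap.id) : LinearMap.det f ≠ 0 := by
  intro h0
  have := congrArg LinearMap.det h
  rw [LinearMap.det_comp, h0, zero_mul, LinearMap.det_id] at this
  exact zero_ne_one this

local notation "tLR" => LinearMap.comp_apply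

lemma TA_det : LinearMap.det (TA ρ LinearMap.id) ^ Module.finrank K H = 1 := by
  apply det_pent _ (TA (Algebra.lmul K H) LinearMap.id) (det_ne_of_inv (TA_inv ρ)) (det_ne_of_inv (TA_inv _))
  ext a b w
  simp only [AlgebraTensorModule.curry_apply, LinearMap.restrictScalars_self, curry_apply,
    LinearMap.comp_apply]
  simp only [ins2_tmul, ins3_tmul, Y12_eq, X13_eq, X23_eq, TA_tmul, map_sw, LinearMap.comp_apply, mk_apply, LinearMap.flip_apply, LinearEquiv.coe_coe, assoc_tmul, leftComm_tmul, LinearMap.id_apply, Algebra.coe_lmul_eq_mul, LinearMap.mul_apply']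
  calc _ = sw K a (fun a1 r => sw K r (fun a2 a3 => sw K b (fun b1 b2 => a1 ⊗ₜ[K] ((a2 * b1) ⊗ₜ[K] ρ (a3 * b2) w)))) := by
        apply sw_congr; intro a1 r
        exact swM (K := K) r b (fun p q => a1 ⊗ₜ[K] (p ⊗ₜ[K] ρ q w))
    _ = sw K a (fun r a3 => sw K r (fun a1 a2 => sw K b (fun b1 b2 => a1 ⊗ₜ[K] ((a2 * b1) ⊗ₜ[K] ρ (a3 * b2) w)))) := 
        (swA a (fun a1 a2 a3 => sw K b (fun b1 b2 => a1 ⊗ₜ[K] ((a2 * b1) ⊗ₜ[K] ρ (a3 * b2) w)))).symm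
    _ = _ := by
        rw [← sw_comm]
        apply sw_congr; intro r a3
        rw [sw_comm]; simp

variable (S4 : ∀ z : H, S2 K H (S2 K H z) = z)
include S4 in
lemma TB_det : LinearMap.det (TB ρ LinearMap.id) ^ Module.finrank K H = 1 := by
  apply det_pent _ (TB (Algebra.lmul K H) LinearMap.id) (det_ne_of_inv (TB_inv ρ S4)) (det_ne_of_inv (TB_inv _ S4))
  ext a b w
  simp only [AlgebraTensorModule.curry_apply, LinearMap.restrictScalars_self, curry_apply,
    LinearMap.comp_apply]
  simp only [ins2_tmul, ins3_tmul, Y12_eq, X13_eq, X23_eq, TB_tmul, map_sw, LinearMap.comp_apply, mk_apply, LinearMap.flip_apply, LinearEquiv.coe_coe, assoc_tmul, leftComm_tmul, LinearMap.id_apply, Algebra.coe_lmul_eq_mul, LinearMap.mul_apply']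
  calc _ = sw K a (fun r a3 => sw K r (fun a1 a2 => sw K b (fun b1 b2 => a3 ⊗ₜ[K] ((a2 * b2) ⊗ₜ[K] ρ (a1 * b1) w)))) := by
        apply sw_congr; intro r a3
        exact swM (K := K) r b (fun p q => a3 ⊗ₜ[K] (q ⊗ₜ[K] ρ p w))
    _ = sw K a (fun a1 r => sw K r (fun a2 a3 => sw K b (fun b1 b2 => a3 ⊗ₜ[K] ((a2 * b2) ⊗ₜ[K] ρ (a1 * b1) w)))) := 
        (swA a (fun a1 a2 a3 => sw K b (fun b1 b2 => a3 ⊗ₜ[K] ((a2 * b2) ⊗ₜ[K] ρ (a1 * b1) w))))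
    _ = _ := by
        rw [← sw_comm]
        apply sw_congr; intro r a3
        rw [sw_comm]; simp

variable (hδ : ∀ w, TensorProduct.assoc K W H H (LinearMap.rTensor H δ (δ w)) =
      LinearMap.lTensor W (comul (R := K)) (δ w))
  (hε : ∀ w, TensorProduct.rid K W (LinearMap.lTensor W (counit (R := K)) (δ w)) = w)

include S4 hδ hε in
lemma PA_det : LinearMap.det (PA δ LinearMap.id) ^ Module.finrank K H = 1 := by
  apply det_pent' _ (PA (comul (R := K) (A := H)) LinearMap.id) (det_ne_of_inv (PA_inv δ S4 hδ hε)) 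
    (det_ne_of_inv (PA_inv _ S4 (fun w => coassoc_apply w) (fun w => by simp)))
  ext a b w
  simp only [AlgebraTensorModule.curry_apply, LinearMap.restrictScalars_self, curry_apply,
    LinearMap.comp_apply]
  simp only [ins2_tmul, ins3_tmul, Y12_eq, X13_eq, X23_eq, PA_tmul, map_tsum, LinearMap.comp_apply, mk_apply, LinearMap.flip_apply, LinearEquiv.coe_coe, assoc_tmul, leftComm_tmul, LinearMap.id_apply]
  calc _ = tsum (δ w) (fun w0 r => sw K b (fun b1 b2 => sw K r (fun w1 w2 => (a * (b2 * w2)) ⊗ₜ[K] ((b1 * w1) ⊗ₜ[K] w0)))) := by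
        apply tsum_congr; intro w0 r
        exact swM (K := K) b r (fun p q => (a * q) ⊗ₜ[K] (p ⊗ₜ[K] w0))
    _ = sw K b (fun b1 b2 => tsum (δ w) (fun w0 r => sw K r (fun w1 w2 => (a * (b2 * w2)) ⊗ₜ[K] ((b1 * w1) ⊗ₜ[K] w0)))) := tsum_comm _ _ _
    _ = _ := by
        apply sw_congr; intro b1 b2
        rw [← cA δ hδ w (fun w0 w1 w2 => (a * (b2 * w2)) ⊗ₜ[K] ((b1 * w1) ⊗ₜ[K] w0))]
        simp [mul_assoc]

include hδ hε in
lemma PB_det : LinearMap.det (PB δ LinearMap.id) ^ Module.finrank K H = 1 := by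
  apply det_pent' _ (PB (comul (R := K) (A := H)) LinearMap.id) (det_ne_of_inv (PB_inv δ hδ hε)) 
    (det_ne_of_inv (PB_inv _ (fun w => coassoc_apply w) (fun w => by simp)))
  ext a b w
  simp only [AlgebraTensorModule.curry_apply, LinearMap.restrictScalars_self, curry_apply,
    LinearMap.comp_apply]
  simp only [ins2_tmul, ins3_tmul, Y12_eq, X13_eq, X23_eq, PB_tmul, map_tsum, LinearMap.comp_apply, mk_apply, LinearMap.flip_apply, LinearEquiv.coe_coe, assoc_tmul, leftComm_tmul, LinearMap.id_apply]
  calc _ = tsum (δ w) (fun w0 r => sw K r (fun w1 w2 => sw K b (fun b1 b2 => (w2 * b2 * a) ⊗ₜ[K] ((w1 * b1) ⊗ₜ[K] w0)))) := by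
        apply tsum_congr; intro w0 r
        exact swM (K := K) r b (fun p q => (q * a) ⊗ₜ[K] (p ⊗ₜ[K] w0))
    _ = tsum (δ w) (fun w0 r => sw K b (fun b1 b2 => sw K r (fun w1 w2 => (w2 * b2 * a) ⊗ₜ[K] ((w1 * b1) ⊗ₜ[K] w0)))) := by
        apply tsum_congr; intro w0 r
        exact sw_comm _ _ _
    _ = sw K b (fun b1 b2 => tsum (δ w) (fun w0 r => sw K r (fun w1 w2 => (w2 * b2 * a) ⊗ₜ[K] ((w1 * b1) ⊗ₜ[K] w0)))) := tsum_comm _ _ _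
    _ = _ := by
        apply sw_congr; intro b1 b2
        rw [← cA δ hδ w (fun w0 w1 w2 => (w2 * b2 * a) ⊗ₜ[K] ((w1 * b1) ⊗ₜ[K] w0))]
        simp [mul_assoc]

/-- Yetter--Drinfeld compatibility -/
structure YD (K : Type*) [Field K] {H : Type*} [Ring H] [HopfAlgebra K H] [FiniteDimensional K H]
    {W : Type*} [AddCommGroup W] [Module K W]
    (ρ : H →ₐ[K] Module.End K W) (δ : W →ₗ[K] W ⊗[K] H) : Prop where
  coa : ∀ w, TensorProduct.assoc K W H H (LinearMap.rTensor H δ (δ w)) =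
      LinearMap.lTensor W (comul (R := K)) (δ w)
  cou : ∀ w, TensorProduct.rid K W (LinearMap.lTensor W (counit (R := K)) (δ w)) = w
  yd : ∀ (h : H) (w : W), δ (ρ h w) = sw K h (fun h1 r => sw K r (fun h2 h3 => 
    tsum (δ w) (fun w0 w1 => (ρ h2 w0) ⊗ₜ[K] (h3 * w1 * antipode K h1))))

variable {ρ δ}

lemma YD.main (Y : YD K ρ δ) (μ : K) (hμ : ∀ w, tsum (δ w) (fun w0 w1 => ρ w1 w0) = μ • w) :
    TB ρ LinearMap.id ∘ₗ PA δ LinearMap.id = 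
      μ • (PB δ LinearMap.id ∘ₗ LinearMap.rTensor W (S2 K H) ∘ₗ TA ρ LinearMap.id) := by
  apply TensorProduct.ext'
  intro a w
  have hb : ∀ a0 : H, Bil K (fun (w0 : W) (w1 : H) => (w1 * a0) ⊗ₜ[K] w0) := by
    intro a0; constructor <;> intros <;> simp [tmul_add, add_tmul, add_mul, ← smul_tmul']
  calc _ = tsum (δ w) (fun w0 r => sw K a (fun a1 a2 => sw K r (fun w1 w2 => (a2 * w2) ⊗ₜ[K] ρ (a1 * w1) w0))) := by
        rw [LinearMap.comp_apply, PA_tmul, map_tsum]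
        apply tsum_congr; intro w0 r
        rw [TB_tmul]
        simp only [LinearMap.id_apply]
        exact swM a r (fun p q => q ⊗ₜ[K] ρ p w0)
    _ = sw K a (fun a1 a2 => tsum (δ w) (fun w0 r => sw K r (fun w1 w2 => (a2 * w2) ⊗ₜ[K] ρ (a1 * w1) w0))) := tsum_comm _ _ _
    _ = sw K a (fun a1 a2 => tsum (δ w) (fun w0 w2 => μ • ((a2 * w2) ⊗ₜ[K] ρ a1 w0))) := by
        apply sw_congr; intro a1 a2
        rw [← cA δ Y.coa w (fun w0 w1 w2 => (a2 * w2) ⊗ₜ[K] ρ (a1 * w1) w0)]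
        apply tsum_congr; intro w0 w2
        have := congrArg ((TensorProduct.mk K H W (a2 * w2)) ∘ₗ (ρ a1)) (hμ w0)
        rw [map_tsum] at this
        simpa using this
    _ = μ • sw K a (fun a1 a2 => tsum (δ w) (fun w0 w2 => ((a2 * w2) ⊗ₜ[K] ρ a1 w0))) := by
        simp only [tsum_smul, sw_smul_right]
    _ = _ := by
        rw [LinearMap.smul_apply, LinearMap.comp_apply, LinearMap.comp_apply, TA_tmul, map_sw, map_sw]
        congr 1
        simp only [LinearMap.rTensor_tmul, PB_tmul, LinearMap.id_apply]
        symm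
        calc _ = sw K a (fun a1 s => sw K s (fun a2 r => sw K r (fun a3 a4 => 
            tsum (δ w) (fun w0 w1 => (a4 * w1 * (antipode K a2 * S2 K H a1)) ⊗ₜ[K] (ρ a3 w0))))) := by
              apply sw_congr; intro a1 s
              rw [tsum_eq _ (hb _), Y.yd, map_sw]
              apply sw_congr; intro a2 r
              rw [map_sw]
              apply sw_congr; intro a3 a4
              rw [map_tsum]
              simp [mul_assoc]
          _ = sw K a (fun s r => sw K s (fun a1 a2 => sw K r (fun a3 a4 => 
            tsum (δ w) (fun w0 w1 => (a4 * w1 * (antipode K a2 * S2 K H a1)) ⊗ₜ[K] (ρ a3 w0))))) :=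
              (swA a (fun a1 a2 r => sw K r (fun a3 a4 => 
            tsum (δ w) (fun w0 w1 => (a4 * w1 * (antipode K a2 * S2 K H a1)) ⊗ₜ[K] (ρ a3 w0))))).symm
          _ = sw K a (fun s r => counit (R := K) s • sw K r (fun a3 a4 => 
            tsum (δ w) (fun w0 w1 => (a4 * w1) ⊗ₜ[K] (ρ a3 w0)))) := by
              apply sw_congr; intro s r
              have := swSl (K := K) s (fun z => sw K r (fun a3 a4 => 
            tsum (δ w) (fun w0 w1 => (a4 * w1 * antipode K z) ⊗ₜ[K] (ρ a3 w0))))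
              simpa [antipode_mul, S2_apply] using this
          _ = _ := swEl a (fun r => sw K r (fun a3 a4 => 
            tsum (δ w) (fun w0 w1 => (a4 * w1) ⊗ₜ[K] (ρ a3 w0))))

include S4 in
lemma YD.root [Nontrivial W] [Nontrivial H] (Y : YD K ρ δ) (μ : K) (hμ : ∀ w, tsum (δ w) (fun w0 w1 => ρ w1 w0) = μ • w) :
    ∃ N : ℕ, 0 < N ∧ μ ^ N = 1 := by
  have h := congrArg LinearMap.det (Y.main μ hμ)
  simp only [LinearMap.det_comp, LinearMap.det_smul] at h
  have hs : LinearMap.det (LinearMap.rTensor W (S2 K H)) ^ 2 = 1 := by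
    rw [sq, ← LinearMap.det_comp, ← LinearMap.rTensor_comp]
    have : S2 K H ∘ₗ S2 K H = LinearMap.id := by ext z; exact S4 z
    rw [this]; simp
  have h2 := congrArg (fun z => z ^ (Module.finrank K H * 2)) h
  simp only [mul_pow] at h2
  have h1 := PB_det δ Y.coa Y.cou
  have h3 := PA_det δ S4 Y.coa Y.cou
  have h4 := TA_det ρ
  have h5 := TB_det ρ S4
  simp only [pow_mul, h1, h3, h4, h5] at h2
  rw [pow_right_comm (LinearMap.det (LinearMap.rTensor W (S2 K H)))] at h2
  rw [hs] at h2
  simp only [one_pow, mul_one, ← pow_mul] at h2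
  refine ⟨_, ?_, h2.symm⟩
  have := Module.finrank_pos (R := K) (M := H)
  have := Module.finrank_pos (R := K) (M := H ⊗[K] W)
  positivity

end pent
end SD

namespace SD
set_option linter.all false
open TensorProduct Coalgebra HopfAlgebra

section yd
variable {K : Type*} [Field K]
variable {H : Type*} [Ring H] [HopfAlgebra K H] [FiniteDimensional K H]
variable {V W M : Type*} [AddCommGroup V] [Module K V] [AddCommGroup W] [Module K W]

/-- the space `H ⊗ V` -/
def HV (K H V : Type*) [Field K] [Ring H] [HopfAlgebra K H] [AddCommGroup V] [Module K V] : Type _ := H ⊗[K] V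

noncomputable instance : AddCommGroup (HV K H V) := inferInstanceAs (AddCommGroup (H ⊗[K] V))
noncomputable instance : Module K (HV K H V) := inferInstanceAs (Module K (H ⊗[K] V))
instance [FiniteDimensional K V] : FiniteDimensional K (HV K H V) := inferInstanceAs (FiniteDimensional K (H ⊗[K] V))

variable (K H V) in
/-- pure tensors -/
noncomputable def hv : H →ₗ[K] V →ₗ[K] HV K H V := TensorProduct.mk K H V
local notation "hw" => hv K H V

/-- linear maps out of `HV` -/
noncomputable def tlv {A : Type*} [AddCommGroup A] [Module K A] (F : H → V → A) (hF : Bil K F) : HV K H V →ₗ[K] A := tl F hF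

lemma tlv_hv {A : Type*} [AddCommGroup A] [Module K A] (F : H → V → A) (hF : Bil K F) (x : H) (v : V) : 
   tlv F hF (hw x v) = F x v := rfl

lemma hv_ext {A : Type*} [AddCommMonoid A] [Module K A] (f g : HV K H V →ₗ[K] A) (h : ∀ a b, f (hw a b) = g (hw a b)) (w) : f w = g w := by
  have : f = g := TensorProduct.ext' h
  rw [this]

variable (σ : H →ₐ[K] Module.End K V) 

/-- the action on `H ⊗ V` for fixed element -/
noncomputable def adF (h : H) : HV K H V →ₗ[K] HV K H V :=
  tlv (fun x v => sw K h (fun h1 r => sw K r (fun h2 h3 => hw (h3 * x * antipode K h1) (σ h2 v)))) (by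
    constructor <;> intros <;> simp [sw, tsum, mul_add, add_mul, tmul_add, add_tmul, ← smul_tmul', Finset.sum_add_distrib, Finset.smul_sum])

lemma adF_hv (h x : H) (v : V) : adF σ h (hw x v) = 
  sw K h (fun h1 r => sw K r (fun h2 h3 => hw (h3 * x * antipode K h1) (σ h2 v))) := rfl

lemma adF_bil (x : H) (v : V) : Bil K (fun (h1 r : H) => sw K r (fun h2 h3 => hw (h3 * x * antipode K h1) (σ h2 v))) := by
  constructor <;> intros <;> simp [sw, tsum, mul_add, add_mul, tmul_add, add_tmul, ← smul_tmul', Finset.sum_add_distrib, Finset.smul_sum]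

/-- the action on `H ⊗ V`, linear form -/
noncomputable def adL : H →ₗ[K] Module.End K (HV K H V) where
  toFun h := adF σ h
  map_add' a b := by
    apply LinearMap.ext; apply hv_ext
    intro x v
    rw [LinearMap.add_apply, adF_hv, adF_hv, adF_hv, sw_add _ _ _ (adF_bil σ x v)]
  map_smul' a b := by
    apply LinearMap.ext; apply hv_ext
    intro x v
    rw [LinearMap.smul_apply, adF_hv, RingHom.id_apply, adF_hv, sw_smul _ _ _ (adF_bil σ x v)]

/-- the action on `H ⊗ V` -/
noncomputable def ad : H →ₐ[K] Module.End K (HV K H V) :=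
  AlgHom.ofLinearMap (adL σ) (by
    apply LinearMap.ext; apply hv_ext
    intro x v
    change adF σ 1 (hw x v) = _
    rw [adF_hv, sw_one _ (adF_bil σ x v), sw_one _ ⟨by simp, by simp [add_mul], by simp, by simp⟩]
    simp) (by
    intro h k
    apply LinearMap.ext; apply hv_ext
    intro x v
    change adF σ (h * k) (hw x v) = adF σ h (adF σ k (hw x v))
    rw [adF_hv, sw_mul _ _ _ (adF_bil σ x v), adF_hv, map_sw]
    simp only [map_sw, adF_hv]
    rw [sw_comm]
    apply sw_congr; intro k1 s
    rw [sw_comm s h]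
    apply sw_congr; intro h1 r
    rw [swM (K := K) r s (fun p q => hw (q * x * antipode K (h1 * k1)) (σ p v))]
    rw [sw_comm]
    simp [antipode_mul, mul_assoc])

lemma ad_hv (h x : H) (v : V) : ad σ h (hw x v) = 
  sw K h (fun h1 r => sw K r (fun h2 h3 => hw (h3 * x * antipode K h1) (σ h2 v))) := rfl

variable (K H V) in
/-- the coaction on `H ⊗ V` -/
noncomputable def dM : HV K H V →ₗ[K] HV K H V ⊗[K] H :=
  tlv (fun (x : H) (v : V) => sw K x (fun (x1 x2 : H) => (hw x1 v) ⊗ₜ[K] x2)) (by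
    constructor <;> intros <;> simp [sw, tsum, tmul_add, add_tmul, ← smul_tmul', Finset.sum_add_distrib, Finset.smul_sum])

lemma dM_hv (x : H) (v : V) : dM K H V (hw x v) = sw K x (fun x1 x2 => (hw x1 v) ⊗ₜ[K] x2) := rfl

lemma dM_sum {A : Type*} [AddCommGroup A] [Module K A] (F : HV K H V → H → A) (hF : Bil K F) (x : H) (v : V) :
    tsum (dM K H V (hw x v)) F = sw K x (fun x1 x2 => F (hw x1 v) x2) := by
  rw [dM_hv, tsum_eq _ hF, map_sw]; rfl

lemma dM_coa (w) : TensorProduct.assoc K (HV K H V) H H (LinearMap.rTensor H (dM K H V) (dM K H V w)) =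
      LinearMap.lTensor (HV K H V) (comul (R := K) (A := H)) (dM K H V w) := by
  refine hv_ext ((TensorProduct.assoc K (HV K H V) H H).toLinearMap ∘ₗ (LinearMap.rTensor H (dM K H V)) ∘ₗ (dM K H V))
    (LinearMap.lTensor (HV K H V) (comul (R := K) (A := H)) ∘ₗ (dM K H V)) ?_ w
  intro x v
  simp only [LinearMap.comp_apply, dM_hv, map_sw, LinearMap.rTensor_tmul, LinearMap.lTensor_tmul]
  calc _ = sw K x (fun x1 x2 => sw K x1 (fun p q => (hw p v) ⊗ₜ[K] (q ⊗ₜ[K] x2))) := by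
        apply sw_congr; intro x1 x2
        exact map_sw (K := K) ((TensorProduct.assoc K (HV K H V) H H).toLinearMap ∘ₗ (TensorProduct.mk K (HV K H V ⊗[K] H) H).flip x2) x1 (fun p q => (hw p v) ⊗ₜ[K] q)
    _ = sw K x (fun p r => sw K r (fun q t => (hw p v) ⊗ₜ[K] (q ⊗ₜ[K] t))) := 
        swA x (fun p q x2 => (hw p v) ⊗ₜ[K] (q ⊗ₜ[K] x2))
    _ = _ := by
        apply sw_congr; intro p r
        rw [← sw_self r]
        exact (map_sw (TensorProduct.mk K (HV K H V) (H ⊗[K] H) (hw p v)) r _).symm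

lemma dM_cou (w) : TensorProduct.rid K (HV K H V) (LinearMap.lTensor (HV K H V) (counit (R := K)) (dM K H V w)) = w := by
  refine hv_ext ((TensorProduct.rid K (HV K H V)).toLinearMap ∘ₗ (LinearMap.lTensor (HV K H V) (counit (R := K))) ∘ₗ (dM K H V))
    LinearMap.id ?_ w
  intro x v
  simp only [LinearMap.comp_apply, dM_hv, map_sw, LinearMap.rTensor_tmul, LinearMap.lTensor_tmul, LinearEquiv.coe_coe, rid_tmul]
  exact swEr (K := K) x (fun a => hw a v)

lemma dM_yd (h : H) (w) : dM K H V (ad σ h w) = sw K h (fun h1 r => sw K r (fun h2 h3 => 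
    tsum (dM K H V w) (fun w0 w1 => (ad σ h2 w0) ⊗ₜ[K] (h3 * w1 * antipode K h1)))) := by
  have hb : ∀ a b c : H, Bil K (fun (w0 : HV K H V) (w1 : H) => (ad σ b w0) ⊗ₜ[K] (c * w1 * antipode K a)) := by
    intros; constructor <;> intros <;> simp [tmul_add, add_tmul, mul_add, add_mul, ← smul_tmul']
  let R : HV K H V →ₗ[K] HV K H V ⊗[K] H :=
    { toFun := fun w => sw K h (fun h1 r => sw K r (fun h2 h3 => 
        tsum (dM K H V w) (fun w0 w1 => (ad σ h2 w0) ⊗ₜ[K] (h3 * w1 * antipode K h1))))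
      map_add' := by intro a b; simp [sw, tsum, add_tmul, Finset.sum_add_distrib]
      map_smul' := by intro a b; simp [sw, tsum, ← smul_tmul', Finset.smul_sum] }
  refine hv_ext ((dM K H V) ∘ₗ ad σ h) R ?_ w
  intro x v
  change dM K H V (ad σ h (hw x v)) = sw K h (fun h1 r => sw K r (fun h2 h3 => 
    tsum (dM K H V (hw x v)) (fun w0 w1 => (ad σ h2 w0) ⊗ₜ[K] (h3 * w1 * antipode K h1))))
  simp only [dM_sum _ (hb _ _ _)]
  simp only [ad_hv, map_sw, dM_hv]
  have inner : ∀ h1 s a3 : H, sw K (s * x * antipode K h1) (fun p q => (hw p (σ a3 v)) ⊗ₜ[K] q) =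
      sw K x (fun x1 x2 => sw K h1 (fun a1 a2 => sw K s (fun a4 a5 => (hw (a4 * x1 * antipode K a2) (σ a3 v)) ⊗ₜ[K] (a5 * x2 * antipode K a1)))) := by
    intro h1 s a3
    rw [mul_assoc, swM (K := K) s (x * antipode K h1) (fun p q => (hw p (σ a3 v)) ⊗ₜ[K] q)]
    rw [sw_comm (K := K) x h1, sw_comm (K := K) h1 x]
    have : ∀ a4 a5 : H, sw K (x * antipode K h1) (fun c d => (hw (a4 * c) (σ a3 v)) ⊗ₜ[K] (a5 * d)) =
       sw K x (fun x1 x2 => sw K h1 (fun a1 a2 => (hw (a4 * x1 * antipode K a2) (σ a3 v)) ⊗ₜ[K] (a5 * x2 * antipode K a1))) := by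
      intro a4 a5
      rw [swM (K := K) x (antipode K h1) (fun p q => (hw (a4 * p) (σ a3 v)) ⊗ₜ[K] (a5 * q))]
      apply sw_congr; intro x1 x2
      rw [swS (K := K) h1 (fun p q => (hw (a4 * (x1 * p)) (σ a3 v)) ⊗ₜ[K] (a5 * (x2 * q)))]
      simp only [mul_assoc]
    simp only [this]
    rw [sw_comm]
    apply sw_congr; intro x1 x2
    rw [sw_comm]
  simp only [inner]
  have e1 : ∀ h1 r : H, sw K r (fun a3 s => sw K x (fun x1 x2 => sw K h1 (fun a1 a2 => sw K s (fun a4 a5 => (hw (a4 * x1 * antipode K a2) (σ a3 v)) ⊗ₜ[K] (a5 * x2 * antipode K a1))))) =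
      sw K x (fun x1 x2 => sw K h1 (fun a1 a2 => sw K r (fun a3 s => sw K s (fun a4 a5 => (hw (a4 * x1 * antipode K a2) (σ a3 v)) ⊗ₜ[K] (a5 * x2 * antipode K a1))))) := by
    intro h1 r
    rw [sw_comm]
    apply sw_congr; intro x1 x2
    rw [sw_comm]
  simp only [e1]
  rw [sw_comm h x]
  have e2 : ∀ a1 t : H, sw K t (fun c a5 => sw K x (fun x1 x2 => sw K c (fun a2 b => sw K b (fun a3 a4 => (hw (a4 * x1 * antipode K a2) (σ a3 v)) ⊗ₜ[K] (a5 * x2 * antipode K a1))))) =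
      sw K x (fun x1 x2 => sw K t (fun c a5 => sw K c (fun a2 b => sw K b (fun a3 a4 => (hw (a4 * x1 * antipode K a2) (σ a3 v)) ⊗ₜ[K] (a5 * x2 * antipode K a1))))) := by
    intro a1 t
    exact sw_comm _ _ _
  have e3 : ∀ x1 x2 : H, sw K h (fun a1 t => sw K t (fun c a5 => sw K c (fun a2 b => sw K b (fun a3 a4 => (hw (a4 * x1 * antipode K a2) (σ a3 v)) ⊗ₜ[K] (a5 * x2 * antipode K a1))))) = 
      sw K h (fun h1 r => sw K h1 (fun a1 a2 => sw K r (fun a3 s => sw K s (fun a4 a5 => (hw (a4 * x1 * antipode K a2) (σ a3 v)) ⊗ₜ[K] (a5 * x2 * antipode K a1))))) := by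
    intro x1 x2
    symm
    calc _ = sw K h (fun a1 t => sw K t (fun a2 r => sw K r (fun a3 s => sw K s (fun a4 a5 => (hw (a4 * x1 * antipode K a2) (σ a3 v)) ⊗ₜ[K] (a5 * x2 * antipode K a1))))) :=
          swA h (fun a1 a2 r => sw K r (fun a3 s => sw K s (fun a4 a5 => (hw (a4 * x1 * antipode K a2) (σ a3 v)) ⊗ₜ[K] (a5 * x2 * antipode K a1))))
      _ = sw K h (fun a1 t => sw K t (fun a2 u => sw K u (fun b a5 => sw K b (fun a3 a4 => (hw (a4 * x1 * antipode K a2) (σ a3 v)) ⊗ₜ[K] (a5 * x2 * antipode K a1))))) := by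
          apply sw_congr; intro a1 t
          apply sw_congr; intro a2 u
          exact (swA u (fun a3 a4 a5 => (hw (a4 * x1 * antipode K a2) (σ a3 v)) ⊗ₜ[K] (a5 * x2 * antipode K a1))).symm
      _ = _ := by
          apply sw_congr; intro a1 t
          exact (swA t (fun a2 b a5 => sw K b (fun a3 a4 => (hw (a4 * x1 * antipode K a2) (σ a3 v)) ⊗ₜ[K] (a5 * x2 * antipode K a1)))).symm
  have e0 : ∀ c z x1 : H, (sw K c (fun a2 b => sw K b (fun a3 a4 => hw (a4 * x1 * antipode K a2) (σ a3 v)))) ⊗ₜ[K] z =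
      sw K c (fun a2 b => sw K b (fun a3 a4 => (hw (a4 * x1 * antipode K a2) (σ a3 v)) ⊗ₜ[K] z)) := by
    intro c z x1
    have := map_sw (K := K) ((TensorProduct.mk K (HV K H V) H).flip z) c (fun a2 b => sw K b (fun a3 a4 => hw (a4 * x1 * antipode K a2) (σ a3 v)))
    refine this.trans ?_
    apply sw_congr; intro a2 b
    exact map_sw (K := K) ((TensorProduct.mk K (HV K H V) H).flip z) b _
  simp only [e0, e2]
  rw [sw_comm h x]
  simp only [e3]

lemma HV_YD : YD K (ad σ) (dM K H V) := ⟨dM_coa, dM_cou, dM_yd σ⟩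

end yd
end SD

namespace SD
set_option linter.all false
open TensorProduct Coalgebra HopfAlgebra

section yd
variable {K : Type*} [Field K]
variable {H : Type*} [Ring H] [HopfAlgebra K H] [FiniteDimensional K H]
variable {V W M : Type*} [AddCommGroup V] [Module K V] [AddCommGroup W] [Module K W]

lemma Tbil (ρ : H →ₐ[K] Module.End K W) : Bil K (fun (w0 : W) (w1 : H) => ρ w1 w0) := by
  constructor <;> intros <;> simp

lemma YD.comm {ρ : H →ₐ[K] Module.End K W} {δ : W →ₗ[K] W ⊗[K] H} (Y : YD K ρ δ) (h : H) (w : W) :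
    tsum (δ (ρ h w)) (fun w0 w1 => ρ w1 w0) = ρ h (tsum (δ w) (fun w0 w1 => ρ w1 w0)) := by
  rw [tsum_eq _ (Tbil ρ), Y.yd, map_sw]
  simp only [map_sw, map_tsum, tl_tmul]
  have e : ∀ h1 h2 h3 : H, tsum (δ w) (fun w0 w1 => ρ (h3 * w1 * antipode K h1) (ρ h2 w0)) =
     tsum (δ w) (fun w0 w1 => ρ h3 (ρ w1 (ρ (antipode K h1 * h2) w0))) := by
    intro h1 h2 h3
    apply tsum_congr; intro w0 w1
    simp
  simp only [e]
  calc _ = sw K h (fun p h3 => sw K p (fun h1 h2 => tsum (δ w) (fun w0 w1 => ρ h3 (ρ w1 (ρ (antipode K h1 * h2) w0))))) :=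
        (swA h (fun h1 h2 h3 => tsum (δ w) (fun w0 w1 => ρ h3 (ρ w1 (ρ (antipode K h1 * h2) w0))))).symm
    _ = sw K h (fun p h3 => counit (R := K) p • tsum (δ w) (fun w0 w1 => ρ h3 (ρ w1 (ρ 1 w0)))) := by
        apply sw_congr; intro p h3
        exact swSl p (fun z => tsum (δ w) (fun w0 w1 => ρ h3 (ρ w1 (ρ z w0))))
    _ = tsum (δ w) (fun w0 w1 => ρ h (ρ w1 (ρ 1 w0))) := swEl h (fun h3 => tsum (δ w) (fun w0 w1 => ρ h3 (ρ w1 (ρ 1 w0))))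
    _ = _ := by apply tsum_congr; intro w0 w1; simp

section restr
variable {ρ : H →ₐ[K] Module.End K W} {δ : W →ₗ[K] W ⊗[K] H} (U : Submodule K W)
  (hρ : ∀ h, ∀ w ∈ U, ρ h w ∈ U) (hδ : ∀ i, ∀ w ∈ U, comp i (δ w) ∈ U)

/-- restricted action -/
noncomputable def rho' : H →ₐ[K] Module.End K U :=
  AlgHom.ofLinearMap { toFun := fun h => (ρ h).restrict (hρ h), map_add' := by intros; ext; simp, map_smul' := by intros; ext; simp }
   (by ext; simp) (by intros; ext; simp)

lemma rho'_coe (h : H) (w : U) : ((rho' U hρ h w : U) : W) = ρ h w := rfl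

/-- restricted coaction -/
noncomputable def del' : U →ₗ[K] U ⊗[K] H :=
  ∑ i, (TensorProduct.mk K U H).flip (Module.finBasis K H i) ∘ₗ ((comp i ∘ₗ δ).restrict (hδ i))

lemma j_del (w : U) : LinearMap.rTensor H U.subtype (del' U hδ w) = δ w := by
  simp only [del', LinearMap.sum_apply, map_sum]
  exact tsum_self (δ (w : W))

lemma tsum_j {A : Type*} [AddCommGroup A] [Module K A] (F : W → H → A) (hF : Bil K F) (t : U ⊗[K] H) :
    tsum t (fun u h => F u h) = tsum (LinearMap.rTensor H U.subtype t) F := by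
  have hF' : Bil K (fun (u : U) h => F u h) := ⟨fun a b => hF.al a b, fun a => hF.ar a, fun c a => hF.sl c a, fun c a => hF.sr c a⟩
  rw [tsum_eq _ hF, tsum_eq _ hF']
  induction t with
  | zero => simp
  | add x y hx hy => simp only [map_add, hx, hy]
  | tmul c d => rfl

lemma tsum_del {A : Type*} [AddCommGroup A] [Module K A] (F : W → H → A) (hF : Bil K F) (w : U) :
    tsum (del' U hδ w) (fun u h => F u h) = tsum (δ w) F := by rw [tsum_j U F hF, j_del]

lemma YD.restr (Y : YD K ρ δ) : YD K (rho' U hρ) (del' U hδ) := by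
  have inj : ∀ (X : Type _) [AddCommGroup X] [Module K X], Function.Injective (LinearMap.rTensor X U.subtype) := by
    intro X _ _
    exact Module.Flat.rTensor_preserves_injective_linearMap _ U.injective_subtype
  refine ⟨?_, ?_, ?_⟩
  · intro w
    apply inj (H ⊗[K] H)
    have e1 : ∀ (s : U ⊗[K] H) (h : H), LinearMap.rTensor (H ⊗[K] H) U.subtype (TensorProduct.assoc K U H H (s ⊗ₜ h)) =
       TensorProduct.assoc K W H H ((LinearMap.rTensor H U.subtype s) ⊗ₜ h) := by
      intro s h
      induction s with
      | zero => simp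
      | add x y hx hy => simp only [map_add, add_tmul, hx, hy]
      | tmul c d => simp
    have e2 : ∀ t : U ⊗[K] H, LinearMap.rTensor (H ⊗[K] H) U.subtype (TensorProduct.assoc K U H H (LinearMap.rTensor H (del' U hδ) t)) =
       TensorProduct.assoc K W H H (LinearMap.rTensor H δ (LinearMap.rTensor H U.subtype t)) := by
      intro t
      induction t with
      | zero => simp
      | add x y hx hy => simp only [map_add, hx, hy]
      | tmul c d => rw [LinearMap.rTensor_tmul, e1, j_del]; simp
    have e3 : ∀ t : U ⊗[K] H, LinearMap.rTensor (H ⊗[K] H) U.subtype (LinearMap.lTensor U (comul (R := K)) t) =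
       LinearMap.lTensor W (comul (R := K)) (LinearMap.rTensor H U.subtype t) := by
      intro t
      induction t with
      | zero => simp
      | add x y hx hy => simp only [map_add, hx, hy]
      | tmul c d => simp
    rw [e2, e3, j_del, Y.coa]
  · intro w
    apply Subtype.ext
    have e : ∀ t : U ⊗[K] H, ((TensorProduct.rid K U (LinearMap.lTensor U (counit (R := K)) t) : U) : W) =
       TensorProduct.rid K W (LinearMap.lTensor W (counit (R := K)) (LinearMap.rTensor H U.subtype t)) := by
      intro t
      induction t with
      | zero => simp
      | add x y hx hy => simp only [map_add, hx, hy, Submodule.coe_add]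
      | tmul c d => simp
    rw [e, j_del, Y.cou]
  · intro h w
    apply inj H
    rw [j_del, rho'_coe, Y.yd, map_sw]
    apply sw_congr; intro h1 r
    rw [map_sw]
    apply sw_congr; intro h2 h3
    rw [map_tsum]
    simp only [LinearMap.rTensor_tmul]
    symm
    refine tsum_del U hδ (fun w0 w1 => (ρ h2 w0) ⊗ₜ[K] (h3 * w1 * antipode K h1)) ?_ w
    constructor <;> intros <;> simp [tmul_add, add_tmul, mul_add, add_mul, ← smul_tmul']

end restr

local notation "hw" => hv K H V

variable (σ : H →ₐ[K] Module.End K V) 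

/-- the operator `x ⊗ v ↦ x₂ ⊗ x₁ v` -/
noncomputable def TH : HV K H V →ₗ[K] HV K H V :=
  tlv (fun x v => sw K x (fun x1 x2 => hw x2 (σ x1 v))) (by
    constructor <;> intros <;> simp [sw, tsum, Finset.sum_add_distrib, Finset.smul_sum])

lemma TH_hv (x : H) (v : V) : TH σ (hw x v) = sw K x (fun x1 x2 => hw x2 (σ x1 v)) := rfl

lemma TH_eq (w : HV K H V) : tsum (dM K H V w) (fun w0 w1 => ad σ w1 w0) = TH σ w := by
  rw [tsum_eq _ (Tbil (ad σ))]
  refine hv_ext ((tl _ (Tbil (ad σ))) ∘ₗ dM K H V) (TH σ) ?_ w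
  intro x v
  rw [LinearMap.comp_apply, dM_hv, map_sw, TH_hv]
  simp only [tl_tmul, ad_hv]
  calc _ = sw K x (fun q r => sw K q (fun x1 x2 => sw K r (fun x3 x4 => hw (x4 * x1 * antipode K x2) (σ x3 v)))) :=
        (swA x (fun x1 x2 r => sw K r (fun x3 x4 => hw (x4 * x1 * antipode K x2) (σ x3 v)))).symm
    _ = sw K x (fun q r => sw K r (fun x3 x4 => sw K q (fun x1 x2 => hw (x4 * (x1 * antipode K x2)) (σ x3 v)))) := by
        apply sw_congr; intro q r
        rw [sw_comm]; simp only [mul_assoc]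
    _ = sw K x (fun q r => sw K r (fun x3 x4 => counit (R := K) q • hw (x4 * 1) (σ x3 v))) := by
        apply sw_congr; intro q r
        apply sw_congr; intro x3 x4
        exact swSr q (fun z => hw (x4 * z) (σ x3 v))
    _ = sw K x (fun q r => counit (R := K) q • sw K r (fun x3 x4 => hw (x4 * 1) (σ x3 v))) := by
        simp only [sw_smul_right]
    _ = sw K x (fun x3 x4 => hw (x4 * 1) (σ x3 v)) := swEl x (fun r => sw K r (fun x3 x4 => hw (x4 * 1) (σ x3 v)))
          ⟨fun a b => sw_add _ _ _ ⟨by simp, by simp [add_mul], by simp, by simp⟩, fun a b => sw_smul _ _ _ ⟨by simp, by simp [add_mul], by simp, by simp⟩⟩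
    _ = _ := by simp only [mul_one]

lemma TH_dM (w : HV K H V) : dM K H V (TH σ w) = LinearMap.rTensor H (TH σ) (dM K H V w) := by
  refine hv_ext (dM K H V ∘ₗ TH σ) (LinearMap.rTensor H (TH σ) ∘ₗ dM K H V) ?_ w
  intro x v
  simp only [LinearMap.comp_apply, TH_hv, dM_hv, map_sw, LinearMap.rTensor_tmul]
  calc _ = sw K x (fun p x3 => sw K p (fun x1 x2 => hw x2 (σ x1 v) ⊗ₜ[K] x3)) :=
        (swA x (fun x1 x2 x3 => hw x2 (σ x1 v) ⊗ₜ[K] x3)).symm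
    _ = _ := by
        apply sw_congr; intro p z
        exact (map_sw (K := K) ((TensorProduct.mk K (HV K H V) H).flip z) p _).symm

lemma comp_rTensor (f : W →ₗ[K] W) (i) (t : W ⊗[K] H) : comp i (LinearMap.rTensor H f t) = f (comp i t) := by
  induction t with
  | zero => simp
  | add x y hx hy => simp only [map_add, hx, hy]
  | tmul c d => simp [comp]

lemma TH_root [FiniteDimensional K V] (S4 : ∀ z : H, S2 K H (S2 K H z) = z) [Nontrivial H] (μ : K) (hμ : Module.End.HasEigenvalue (TH σ) μ) : 
    ∃ N : ℕ, 0 < N ∧ μ ^ N = 1 := by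
  let U := Module.End.eigenspace (TH σ) μ
  have hU : ∀ w, w ∈ U ↔ TH σ w = μ • w := fun w => Module.End.mem_eigenspace_iff
  have hρ : ∀ h, ∀ w ∈ U, ad σ h w ∈ U := by
    intro h w hx
    rw [hU] at hx ⊢
    rw [← TH_eq, (HV_YD σ).comm, TH_eq, hx, map_smul]
  have hδ : ∀ i, ∀ w ∈ U, comp i (dM K H V w) ∈ U := by
    intro i w hx
    rw [hU] at hx ⊢
    rw [← comp_rTensor, ← TH_dM, hx, map_smul, map_smul]
  have : Nontrivial U := by
    rw [Submodule.nontrivial_iff_ne_bot]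
    exact hμ
  refine YD.root S4 ((HV_YD σ).restr U hρ hδ) μ ?_
  intro w
  apply Subtype.ext
  have := (hU w).1 w.2
  rw [Submodule.coe_smul, ← this, ← TH_eq, ← tsum_del U hδ _ (Tbil (ad σ)) w]
  exact map_tsum U.subtype _ _

end yd
end SD

namespace SD
set_option linter.all false
open TensorProduct Coalgebra HopfAlgebra

section fs
variable {K : Type*} [Field K]
variable {H : Type*} [Ring H] [HopfAlgebra K H] [FiniteDimensional K H]
variable {V : Type*} [AddCommGroup V] [Module K V]

/-- the Frobenius-Schur operator -/
noncomputable def gop (e : V ≃ₗ[K] Module.Dual K V) : Module.End K V :=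
  e.symm.toLinearMap ∘ₗ e.toLinearMap.flip

lemma gop_spec (e : V ≃ₗ[K] Module.Dual K V) (v w : V) : e (gop e v) w = e w v := by
  simp [gop]

lemma gop_comm (e : V ≃ₗ[K] Module.Dual K V) (σ : H →ₐ[K] Module.End K V)
    (hb : ∀ h v w, e (σ h v) w = e v (σ (antipode K h) w)) 
    (S4 : ∀ z : H, S2 K H (S2 K H z) = z) (h : H) (v : V) : gop e (σ h v) = σ (S2 K H h) (gop e v) := by
  have h1 : ∀ l v, gop e (σ (S2 K H l) v) = σ l (gop e v) := by
    intro l v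
    apply e.injective
    ext w
    rw [gop_spec, hb, gop_spec, hb, S2_apply]
  rw [← h1, S4]

lemma gop_sq (e : V ≃ₗ[K] Module.Dual K V) (σ : H →ₐ[K] Module.End K V)
    (hb : ∀ h v w, e (σ h v) w = e v (σ (antipode K h) w)) 
    (S4 : ∀ z : H, S2 K H (S2 K H z) = z)
    (schur : ∀ A : Module.End K V, (∀ h v, A (σ h v) = σ h (A v)) → ∃ c : K, ∀ v, A v = c • v) :
    gop e ^ 4 = 1 := by
  obtain ⟨c, hc⟩ := schur (gop e ^ 2) (by
    intro h v
    rw [pow_two, Module.End.mul_apply, gop_comm e σ hb S4, gop_comm e σ hb S4, S4]; rfl)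
  have hp : ∀ v w, e (gop e v) (gop e w) = e v w := by
    intro v w; rw [gop_spec, gop_spec]
  have hc' : ∀ v, gop e (gop e v) = c • v := fun v => by rw [← hc v, pow_two]; rfl
  ext v
  have : (gop e ^ 4) v = gop e (gop e (gop e (gop e v))) := by
    simp [pow_succ]
  rw [this, hc', hc', smul_smul]
  apply e.injective
  ext w
  have h2 : e (gop e (gop e v)) (gop e (gop e w)) = e v w := by rw [hp, hp]
  rw [hc', hc'] at h2
  rw [Module.End.one_apply, ← h2]
  simp [mul_assoc]

variable {Λ : H}

lemma Lam_move (I : Intg K Λ) {M : Type*} [AddCommGroup M] [Module K M] (F : H → H → M) (hF : Bil K F) (h : H) :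
    sw K Λ (fun a b => F (a * h) b) = sw K Λ (fun a b => F a (b * antipode K h)) := by
  let L : H →ₗ[K] H →ₗ[K] M := LinearMap.mk₂ K F hF.al hF.sl hF.ar hF.sr
  have hL : ∀ a b, F a b = L a b := fun a b => rfl
  simp only [hL]
  clear_value L
  calc _ = sw K h (fun h1 r => counit (R := K) r • sw K Λ (fun a b => L (a * h1) (b * 1))) := by
        rw [swEr (K := K) h (fun h1 => sw K Λ (fun a b => L (a * h1) (b * 1)))]
        simp only [mul_one]
    _ = sw K h (fun h1 r => sw K r (fun h2 q => sw K Λ (fun a b => L (a * h1) (b * (h2 * antipode K q))))) := by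
        apply sw_congr; intro h1 r
        exact (swSr (K := K) r (fun z => sw K Λ (fun a b => L (a * h1) (b * z)))).symm
    _ = sw K h (fun p q => sw K p (fun h1 h2 => sw K Λ (fun a b => L (a * h1) (b * (h2 * antipode K q))))) :=
        (swA (K := K) h (fun h1 h2 q => sw K Λ (fun a b => L (a * h1) (b * (h2 * antipode K q))))).symm
    _ = sw K h (fun p q => counit (R := K) p • sw K Λ (fun x y => L x (y * antipode K q))) := by
        apply sw_congr; intro p q
        have hB : Bil K (fun x y => L x (y * antipode K q)) := by
          constructor <;> intros <;> simp [add_mul]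
        rw [← sw_smul _ _ _ hB, ← I.r, sw_mul _ _ _ hB, sw_comm]
        simp only [mul_assoc]
    _ = _ := swEl (K := K) h (fun q => sw K Λ (fun x y => L x (y * antipode K q)))

lemma FS_trace (e : V ≃ₗ[K] Module.Dual K V) [FiniteDimensional K V] [Nontrivial V] (σ : H →ₐ[K] Module.End K V)
    (hb : ∀ h v w, e (σ h v) w = e v (σ (antipode K h) w)) 
    (S4 : ∀ z : H, S2 K H (S2 K H z) = z)
    (schur : ∀ A : Module.End K V, (∀ h v, A (σ h v) = σ h (A v)) → ∃ c : K, ∀ v, A v = c • v)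
    (I : Intg K Λ) : LinearMap.trace K V (gop e * σ (sw K Λ (fun a b => b * a))) = 1 := by
  let B := Module.finBasis K V
  -- rank one
  have key : ∀ f f' : Module.Dual K V, ∃ c : K, ∀ v w, sw K Λ (fun a b => f (σ a v) * f' (σ b w)) = c * e v w := by
    intro f f'
    let b' : V →ₗ[K] V →ₗ[K] K := LinearMap.mk₂ K (fun v w => sw K Λ (fun a b => f (σ a v) * f' (σ b w)))
      (by intros; simp [sw, tsum, add_mul, Finset.sum_add_distrib])
      (by intros; simp [sw, tsum, mul_assoc, Finset.mul_sum])
      (by intros; simp [sw, tsum, mul_add, Finset.sum_add_distrib])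
      (by intros; simp [sw, tsum, mul_left_comm, Finset.mul_sum])
    obtain ⟨c, hc⟩ := schur (e.symm.toLinearMap ∘ₗ b') (by
      intro h v
      apply e.injective
      ext w
      rw [hb]
      simp only [LinearMap.comp_apply, LinearEquiv.coe_coe, LinearEquiv.apply_symm_apply]
      have := Lam_move I (fun a b => f (σ a v) * f' (σ b w)) (by 
        constructor <;> intros <;> simp [add_mul, mul_add, mul_assoc, mul_left_comm]) h
      simpa [b'] using this)
    refine ⟨c, fun v w => ?_⟩
    have := congrArg (fun u => e u w) (hc v)
    simpa [b'] using this
  choose c hc using fun k j => key (B.coord k) (B.coord j)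
  have e1 : ∑ k, ∑ j, e (B k) (B j) * c k j = 1 := by
    obtain ⟨v, hv⟩ := exists_ne (0 : V)
    have : e v ≠ 0 := by simpa using hv
    obtain ⟨w, hw⟩ : ∃ w, e v w ≠ 0 := by
      by_contra hcon; push_neg at hcon; exact this (LinearMap.ext hcon)
    have h1 : sw K Λ (fun a b => e (σ a v) (σ b w)) = e v w := by
      have := swSl (K := K) Λ (fun z => e v (σ z w))
      rw [I.e] at this
      simp only [hb]
      simpa using this
    have h2 : ∀ x y, e x y = ∑ k, ∑ j, e (B k) (B j) * (B.coord k x * B.coord j y) := by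
      intro x y
      conv_lhs => rw [← B.sum_repr x, ← B.sum_repr y]
      simp only [map_sum, LinearMap.sum_apply, map_smul, LinearMap.smul_apply, smul_eq_mul, Finset.mul_sum]
      rw [Finset.sum_comm]
      apply Finset.sum_congr rfl; intro k _
      apply Finset.sum_congr rfl; intro j _
      simp only [Module.Basis.coord_apply]
      ring
    have h3 : sw K Λ (fun a b => e (σ a v) (σ b w)) = (∑ k, ∑ j, e (B k) (B j) * c k j) * e v w := by
      simp_rw [h2 (σ _ v)]
      simp_rw [Finset.sum_mul, mul_assoc, ← hc]
      simp only [sw, tsum, Finset.mul_sum]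
      rw [Finset.sum_comm]
      apply Finset.sum_congr rfl; intro k _
      rw [Finset.sum_comm]
    rw [h1] at h3
    exact (mul_right_cancel₀ hw (by rw [one_mul]; exact h3)).symm
  rw [LinearMap.trace_mul_comm, LinearMap.trace_eq_matrix_trace K B, Matrix.trace]
  simp only [Matrix.diag, LinearMap.toMatrix_apply, Module.End.mul_apply]
  rw [← e1, Finset.sum_comm]
  apply Finset.sum_congr rfl; intro j _
  have h4 : σ (sw K Λ (fun a b => b * a)) (gop e (B j)) = sw K Λ (fun a b => σ b (σ a (gop e (B j)))) := by
    have := map_sw (K := K) ((LinearMap.applyₗ (gop e (B j))) ∘ₗ σ.toLinearMap) Λ (fun a b => b * a)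
    simpa using this
  rw [h4]
  have h5 : ∀ x : V, B.repr x j = B.coord j x := fun x => rfl
  rw [h5, map_sw]
  have h6 : ∀ a b : H, B.coord j (σ b (σ a (gop e (B j)))) = ∑ k, B.coord k (σ a (gop e (B j))) * B.coord j (σ b (B k)) := by
    intro a b
    conv_lhs => rw [← B.sum_repr (σ a (gop e (B j)))]
    simp only [map_sum, map_smul, smul_eq_mul]
    rfl
  simp only [h6]
  have h7 : ∀ k, e (B k) (B j) * c k j = sw K Λ (fun a b => B.coord k (σ a (gop e (B j))) * B.coord j (σ b (B k))) := by
    intro k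
    rw [hc, gop_spec, mul_comm]
  simp only [h7, sw, tsum]
  rw [Finset.sum_comm]

end fs
end SD

namespace SD
set_option linter.all false
open TensorProduct Coalgebra HopfAlgebra

section tr
variable {K : Type*} [Field K]
variable {H : Type*} [Ring H] [HopfAlgebra K H] [FiniteDimensional K H]
variable {V : Type*} [AddCommGroup V] [Module K V]
local notation "hw" => hv K H V
variable {Λ : H}

/-- the operator `x ↦ f(x₁) S²(x₂)` -/
noncomputable def mop (f : Module.Dual K H) : H →ₗ[K] H :=
  Lin.mk (K := K) (f := fun x => sw K x (fun x1 x2 => f x1 • S2 K H x2)) (by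
    have hB : Bil K (fun x1 x2 : H => f x1 • S2 K H x2) := by
      constructor <;> intros <;> simp [add_smul, mul_smul, smul_comm (f _)]
    exact ⟨fun x y => sw_add _ _ _ hB, fun x y => sw_smul _ _ _ hB⟩)

lemma mop_apply (f : Module.Dual K H) (x : H) : mop f x = sw K x (fun x1 x2 => f x1 • S2 K H x2) := rfl

lemma trace_mop (S4 : ∀ z : H, S2 K H (S2 K H z) = z) (I : Intg K Λ) (f : Module.Dual K H) : 
    LinearMap.trace K H (mop f) = f Λ * lam K H 1 := by
  rw [trace_formula I]
  simp only [mop_apply]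
  have : ∀ a b : H, lam K H (b * antipode K (sw K a (fun x1 x2 => f x1 • S2 K H x2))) = 
      sw K a (fun x1 x2 => f x1 * lam K H (b * Sb K H x2)) := by
    intro a b
    have := map_sw (K := K) (lam K H ∘ₗ LinearMap.mulLeft K b ∘ₗ antipode K) a (fun x1 x2 => f x1 • S2 K H x2)
    simpa [Sb] using this
  simp only [this]
  rw [swA Λ (fun x1 x2 b => f x1 * lam K H (b * Sb K H x2))]
  have : ∀ x1 r : H, sw K r (fun x2 b => f x1 * lam K H (b * Sb K H x2)) = counit (R := K) r • (f x1 * lam K H 1) := by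
    intro x1 r
    exact swBr S4 (K := K) r (fun z => f x1 * lam K H z)
  simp only [this]
  exact swEr (K := K) Λ (fun x1 => f x1 * lam K H 1)

lemma mop_counit : mop (counit (R := K) (A := H)) = S2 K H := by
  ext x
  rw [mop_apply]
  exact swEl (K := K) x (fun z => S2 K H z)

lemma trace_S2 (S4 : ∀ z : H, S2 K H (S2 K H z) = z) (I : Intg K Λ) :
    LinearMap.trace K H (S2 K H) = lam K H 1 := by
  rw [← mop_counit, trace_mop S4 I, I.e, one_mul]

/-- `x ⊗ v ↦ S²(x₂) ⊗ F(x₁) v` -/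
noncomputable def Qop (F : H →ₗ[K] Module.End K V) : HV K H V →ₗ[K] HV K H V :=
  tlv (fun x v => sw K x (fun x1 x2 => hw (S2 K H x2) (F x1 v))) (by
    constructor <;> intros <;> simp [sw, tsum, Finset.sum_add_distrib, Finset.smul_sum])

lemma Qop_hv (F : H →ₗ[K] Module.End K V) (x : H) (v : V) : Qop F (hw x v) = sw K x (fun x1 x2 => hw (S2 K H x2) (F x1 v)) := rfl

lemma trace_Qop [FiniteDimensional K V] (S4 : ∀ z : H, S2 K H (S2 K H z) = z) (I : Intg K Λ) (F : H →ₗ[K] Module.End K V) :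
    LinearMap.trace K (HV K H V) (Qop F) = lam K H 1 * LinearMap.trace K V (F Λ) := by
  let B := Module.finBasis K H
  let Q' : H ⊗[K] V →ₗ[K] H ⊗[K] V := tl (fun x v => sw K x (fun x1 x2 => (S2 K H x2) ⊗ₜ[K] (F x1 v))) (by
    constructor <;> intros <;> simp [sw, tsum, Finset.sum_add_distrib, Finset.smul_sum, tmul_add])
  have h1 : Q' = ∑ i, (TensorProduct.map (mop (B.coord i)) (F (B i)) : H ⊗[K] V →ₗ[K] H ⊗[K] V) := by
    apply TensorProduct.ext'
    intro x v
    rw [LinearMap.sum_apply, tl_tmul]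
    simp only [map_tmul, mop_apply]
    have : ∀ i, (sw K x (fun x1 x2 => B.coord i x1 • S2 K H x2)) ⊗ₜ[K] (F (B i) v) = 
        sw K x (fun x1 x2 => (B.coord i x1 • S2 K H x2) ⊗ₜ[K] (F (B i) v)) := by
      intro i
      exact map_sw (K := K) ((TensorProduct.mk K H V).flip (F (B i) v)) x _
    simp only [this]
    have h2 : ∀ x1 x2 : H, (S2 K H x2) ⊗ₜ[K] (F x1 v) = ∑ i, (B.coord i x1 • S2 K H x2) ⊗ₜ[K] (F (B i) v) := by
      intro x1 x2
      conv_lhs => rw [← B.sum_repr x1]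
      simp only [map_sum, map_smul, LinearMap.sum_apply, LinearMap.smul_apply, tmul_sum, smul_tmul]
      rfl
    simp only [h2]
    simp only [sw, tsum]
    exact Finset.sum_comm
  have h2 : LinearMap.trace K (HV K H V) (Qop F) = LinearMap.trace K (H ⊗[K] V) (∑ i, (TensorProduct.map (mop (B.coord i)) (F (B i)) : H ⊗[K] V →ₗ[K] H ⊗[K] V)) := by
    rw [← h1]; rfl
  rw [h2, map_sum]
  simp only [LinearMap.trace_tensorProduct', trace_mop S4 I]
  conv_rhs => rw [← B.sum_repr Λ]
  simp only [map_sum, map_smul, Finset.mul_sum, smul_eq_mul]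
  apply Finset.sum_congr rfl; intro i _
  simp only [Module.Basis.coord_apply]
  ring

/-- `S² ⊗ g` -/
noncomputable def GH (g : Module.End K V) : HV K H V →ₗ[K] HV K H V :=
  tlv (fun x v => hw (S2 K H x) (g v)) (by
    constructor <;> intros <;> simp)

lemma GH_hv (g : Module.End K V) (x : H) (v : V) : GH g (hw x v) = hw (S2 K H x) (g v) := rfl

lemma GH_four (S4 : ∀ z : H, S2 K H (S2 K H z) = z) (g : Module.End K V) (hg : g ^ 4 = 1) : 
    (GH g : Module.End K (HV K H V)) ^ 4 = 1 := by
  apply LinearMap.ext; apply hv_ext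
  intro x v
  have : g (g (g (g v))) = v := by
    have := congrArg (fun z => z v) hg
    simpa [pow_succ] using this
  simp only [pow_succ, pow_zero, one_mul, Module.End.mul_apply, GH_hv, S4, this, Module.End.one_apply]

variable (σ : H →ₐ[K] Module.End K V)

lemma sw_S2 {M : Type*} [AddCommGroup M] [Module K M] (F : H → H → M) (hF : Bil K F) (x : H) : 
    sw K (S2 K H x) F = sw K x (fun a b => F (S2 K H a) (S2 K H b)) := by
  rw [S2_apply, swS _ F hF, swS _ _ (by constructor <;> intros <;> simp [hF.al, hF.ar, hF.sl, hF.sr])]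
  simp only [S2_apply]

lemma TH_GH (g : Module.End K V) (hg : ∀ h v, g (σ h v) = σ (S2 K H h) (g v)) : 
    Commute (TH σ : Module.End K (HV K H V)) (GH g) := by
  apply LinearMap.ext; apply hv_ext
  intro x v
  simp only [Module.End.mul_apply, GH_hv, TH_hv, map_sw, hg]
  exact sw_S2 (fun a b => hw b (σ a (g v))) (by constructor <;> intros <;> simp) x

lemma trace_one [FiniteDimensional K V] (S4 : ∀ z : H, S2 K H (S2 K H z) = z) (I : Intg K Λ) (g : Module.End K V) (hΛ : σ Λ = 0) :
    LinearMap.trace K (HV K H V) (GH g * TH σ) = 0 := by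
  have : GH g * TH σ = Qop (LinearMap.mulLeft K g ∘ₗ σ.toLinearMap) := by
    apply LinearMap.ext; apply hv_ext
    intro x v
    simp only [Module.End.mul_apply, GH_hv, TH_hv, map_sw, Qop_hv]
    rfl
  rw [this, trace_Qop S4 I]
  simp [hΛ]

lemma trace_two [FiniteDimensional K V] (S4 : ∀ z : H, S2 K H (S2 K H z) = z) (I : Intg K Λ) (g : Module.End K V) 
    (hg : LinearMap.trace K V (g * σ (sw K Λ (fun a b => b * a))) = 1) :
    LinearMap.trace K (HV K H V) (GH g * TH σ ^ 2) = lam K H 1 := by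
  have hB : Bil K (fun a b : H => b * a) := by constructor <;> intros <;> simp [mul_add, add_mul]
  let m : H →ₗ[K] H := tl _ hB ∘ₗ comul (R := K)
  have hm : ∀ x, m x = sw K x (fun a b => b * a) := fun x => (tsum_eq _ hB _).symm
  have : GH g * TH σ ^ 2 = Qop (LinearMap.mulLeft K g ∘ₗ σ.toLinearMap ∘ₗ m) := by
    apply LinearMap.ext; apply hv_ext
    intro x v
    simp only [pow_two, Module.End.mul_apply, GH_hv, TH_hv, map_sw, Qop_hv]
    rw [← swA x (fun x1 x2 x3 => hw (S2 K H x3) (g (σ x2 (σ x1 v))))]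
    apply sw_congr; intro p z
    have := map_sw (K := K) (hw (S2 K H z) ∘ₗ g ∘ₗ LinearMap.applyₗ v ∘ₗ σ.toLinearMap) p (fun a b => b * a)
    simp only [← hm] at this
    simpa using this.symm
  rw [this, trace_Qop S4 I]
  have : (LinearMap.mulLeft K g ∘ₗ σ.toLinearMap ∘ₗ m) Λ = g * σ (sw K Λ (fun a b => b * a)) := by
    rw [← hm]; rfl
  rw [this, hg, mul_one]

end tr

section nt
lemma lift_mset {α β : Type*} (f : α → β) (s : Multiset β) (h : ∀ p ∈ s, ∃ q, f q = p) : ∃ s' : Multiset α, s'.map f = s := by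
  induction s using Multiset.induction with
  | empty => exact ⟨0, rfl⟩
  | cons a s ih =>
    obtain ⟨s', hs⟩ := ih (fun p hp => h p (Multiset.mem_cons_of_mem hp))
    obtain ⟨q, hq⟩ := h a (Multiset.mem_cons_self _ _)
    exact ⟨q ::ₘ s', by simp [hs, hq]⟩

lemma integral_of_root {K : Type*} [Field K] {x : K} {N : ℕ} (hN : 0 < N) (h : x ^ N = 1) : IsIntegral ℤ x := 
  IsIntegral.of_pow hN (by rw [h]; exact isIntegral_one)

lemma even_of_sums {K : Type*} [Field K] [CharZero K] (s : Multiset (K × K)) (t : Multiset K) (D : K) (n : ℕ)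
    (h1 : ∀ p ∈ s, ∃ N : ℕ, 0 < N ∧ p.1 ^ N = 1) (h2 : ∀ p ∈ s, p.2 ^ 4 = 1) (h3 : ∀ q ∈ t, q ^ 2 = 1)
    (e1 : (s.map (fun p => p.1 * p.2)).sum = 0) (e2 : (s.map (fun p => p.1 ^ 2 * p.2)).sum = D)
    (e3 : t.sum = D) (e4 : Multiset.card t = n) : Even n := by
  let O := integralClosure ℤ K
  obtain ⟨s', hs'⟩ := lift_mset (fun q : O × O => ((q.1 : K), (q.2 : K))) s (by
    intro p hp
    obtain ⟨N, hN, h⟩ := h1 p hp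
    exact ⟨(⟨p.1, integral_of_root hN h⟩, ⟨p.2, integral_of_root (by norm_num) (h2 p hp)⟩), rfl⟩)
  obtain ⟨t', ht'⟩ := lift_mset (fun q : O => (q : K)) t (by
    intro p hp
    exact ⟨⟨p, integral_of_root (by norm_num) (h3 p hp)⟩, rfl⟩)
  subst hs' ht'
  have inj : Function.Injective (algebraMap O K) := Subtype.val_injective
  have e1' : (s'.map (fun p => p.1 * p.2)).sum = 0 := by
    apply inj
    rw [map_multiset_sum, Multiset.map_map, map_zero, ← e1, Multiset.map_map]; rfl
  have e2' : (s'.map (fun p => p.1 ^ 2 * p.2)).sum = t'.sum := by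
    apply inj
    rw [map_multiset_sum, Multiset.map_map, map_multiset_sum]
    refine Eq.trans ?_ e3.symm
    rw [← e2, Multiset.map_map]; rfl
  have h2' : ∀ p ∈ s', p.2 ^ 4 = 1 := by
    intro p hp
    apply inj
    rw [map_pow, map_one]
    exact h2 _ (Multiset.mem_map_of_mem _ hp)
  have h3' : ∀ p ∈ t', p ^ 2 = 1 := by
    intro p hp
    apply inj
    rw [map_pow, map_one]
    exact h3 _ (Multiset.mem_map_of_mem _ hp)
  have : (Ideal.span {(2 : ℤ)}).IsMaximal := 
    PrincipalIdealRing.isMaximal_of_irreducible Int.prime_two.irreducible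
  obtain ⟨Q, hQ, hQ2⟩ := Ideal.exists_ideal_over_maximal_of_isIntegral (S := O) (Ideal.span {(2 : ℤ)}) (by
    rw [(RingHom.injective_iff_ker_eq_bot _).1 ((algebraMap ℤ O).injective_int)]
    exact bot_le)
  let π : O →+* O ⧸ Q := Ideal.Quotient.mk Q
  letI : Field (O ⧸ Q) := Ideal.Quotient.field Q
  have z2 : (2 : O ⧸ Q) = 0 := by
    have : (2 : ℤ) ∈ Q.comap (algebraMap ℤ O) := by rw [hQ2]; exact Ideal.mem_span_singleton_self _
    rw [Ideal.mem_comap] at this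
    have := Ideal.Quotient.eq_zero_iff_mem.2 this
    rw [map_ofNat] at this
    exact (map_ofNat π 2).symm.trans this
  haveI : CharP (O ⧸ Q) 2 := CharTwo.of_one_ne_zero_of_two_eq_zero one_ne_zero z2
  haveI : Fact (Nat.Prime 2) := ⟨Nat.prime_two⟩
  have sq1 : ∀ z : O ⧸ Q, z ^ 2 = 1 → z = 1 := by
    intro z hz
    have : (z - 1) ^ 2 = 0 := by
      rw [sub_sq, hz]; linear_combination (1 - z) * z2
    exact sub_eq_zero.1 (pow_eq_zero_iff (two_ne_zero) |>.1 this)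
  have b1 : ∀ p ∈ s', π p.2 = 1 := by
    intro p hp
    apply sq1; apply sq1
    rw [← pow_mul, ← map_pow, h2' p hp, map_one]
  have b2 : ∀ p ∈ t', π p = 1 := by
    intro p hp
    apply sq1
    rw [← map_pow, h3' p hp, map_one]
  have c1 : (s'.map (fun p => π p.1)).sum = 0 := by
    have := congrArg π e1'
    rw [map_multiset_sum, Multiset.map_map, map_zero] at this
    rw [← this]
    congr 1
    apply Multiset.map_congr rfl
    intro p hp; simp [b1 p hp]
  have c2 : (s'.map (fun p => π p.1 ^ 2)).sum = 0 := by
    have := multiset_sum_pow_char 2 (s'.map (fun p => π p.1))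
    rw [c1, Multiset.map_map] at this
    rw [zero_pow two_ne_zero] at this
    exact this.symm
  have c3 := congrArg π e2'
  rw [map_multiset_sum, Multiset.map_map, map_multiset_sum, Multiset.map_congr rfl b2] at c3
  have c4 : (s'.map (π ∘ fun p => p.1 ^ 2 * p.2)) = (s'.map (fun p => π p.1 ^ 2)) := by
    apply Multiset.map_congr rfl
    intro p hp; simp [b1 p hp]
  rw [c4, c2] at c3
  simp only [Multiset.map_const', Multiset.sum_replicate, nsmul_eq_mul, mul_one] at c3
  rw [Multiset.card_map] at e4
  rw [e4] at c3
  have : (n : ℤ) ∈ Q.comap (algebraMap ℤ O) := by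
    rw [Ideal.mem_comap]
    apply Ideal.Quotient.eq_zero_iff_mem.1
    simpa using c3.symm
  rw [hQ2, Ideal.mem_span_singleton] at this
  exact even_iff_two_dvd.2 (by exact_mod_cast this)

end nt
end SD

/-- Let `H` be a semisimple Hopf algebra over an algebraically closed
field `K` of characteristic zero.  If `H` has a nontrivial self-dual simple module,
then the dimension of `H` is even.

Here `V` is a simple `H`-module; its dual `Module.Dual K V` carries the `H`-module
structure `(h • f) v = f (S h • v)` (hypothesis `hdual`); `V` is self-dual
(`hselfdual : V ≃ₗ[H] V*` nonempty) and nontrivial (`hnontrivial`: `V` is not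
isomorphic to the trivial one-dimensional module `K` on which `H` acts through `ε`). -/
theorem self_dual_simple_module_even_dim
    {K H : Type*} [Field K] [IsAlgClosed K] [CharZero K]
    [Ring H] [HopfAlgebra K H] [FiniteDimensional K H]
    [IsSemisimpleRing H]
    (V : Type*) [AddCommGroup V] [Module K V] [Module H V]
    [IsScalarTower K H V] [FiniteDimensional K V]
    [IsSimpleModule H V]
    [Module H (Module.Dual K V)]
    (hdual : ∀ (h : H) (f : Module.Dual K V) (v : V),
      (h • f) v = f (antipode (R := K) h • v))
    (hselfdual : Nonempty (V ≃ₗ[H] Module.Dual K V))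
    (hnontrivial : IsEmpty (V ≃ₗ[H] K)) :
    Even (Module.finrank K H) := by
  haveI : Nontrivial V := IsSimpleModule.nontrivial H V
  haveI : Nontrivial H := by
    by_contra hn
    rw [not_nontrivial_iff_subsingleton] at hn
    obtain ⟨v, hv⟩ := exists_ne (0 : V)
    apply hv
    rw [← one_smul H v, Subsingleton.elim (1 : H) 0, zero_smul]
  obtain ⟨Λ, hl, hr, he⟩ := SD.exists_integral (K := K) (H := H)
  have I : SD.Intg K Λ := ⟨hl, hr, he⟩
  have S4 := SD.S4_one I (SD.lam_one_ne_zero I)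
  have hsc : ∀ (c : K) (v : V), algebraMap K H c • v = c • v := by
    intro c v; rw [Algebra.algebraMap_eq_smul_one, smul_assoc, one_smul]
  have hcomm : ∀ (c : K) (h : H) (v : V), h • c • v = c • h • v := by
    intro c h v
    rw [← hsc, ← hsc, smul_smul, smul_smul, Algebra.commutes]
  let σ : H →ₐ[K] Module.End K V := AlgHom.ofLinearMap
    { toFun := fun h => { toFun := fun v => h • v, map_add' := smul_add h, map_smul' := fun c v => hcomm c h v }
      map_add' := by intro a b; ext v; exact add_smul a b v
      map_smul' := by intro c a; ext v; exact smul_assoc c a v }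
    (by ext v; exact one_smul H v) (by intro a b; ext v; exact mul_smul a b v)
  have hσ : ∀ h v, σ h v = h • v := fun h v => rfl
  obtain ⟨e0⟩ := hselfdual
  let e : V ≃ₗ[K] Module.Dual K V :=
    { e0.toEquiv with
      map_add' := e0.map_add
      map_smul' := by
        intro c v
        apply LinearMap.ext; intro w
        change e0 (c • v) w = (c • e0 v) w
        rw [← hsc, e0.map_smul, hdual]
        have : antipode K (algebraMap K H c) = algebraMap K H c := by
          rw [Algebra.algebraMap_eq_smul_one, map_smul, antipode_one]
        rw [this, hsc, map_smul]; rfl }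
  have hb : ∀ h v w, e (σ h v) w = e v (σ (antipode K h) w) := by
    intro h v w
    change e0 (h • v) w = e0 v (antipode K h • w)
    rw [e0.map_smul, hdual]
  have schur : ∀ A : Module.End K V, (∀ h v, A (σ h v) = σ h (A v)) → ∃ c : K, ∀ v, A v = c • v := by
    intro A hA
    obtain ⟨c, hc⟩ := Module.End.exists_eigenvalue A
    refine ⟨c, ?_⟩
    let U : Submodule H V :=
      { carrier := {v | A v = c • v}
        add_mem' := by
          intro a b ha hb
          simp only [Set.mem_setOf_eq] at ha hb ⊢
          rw [map_add, ha, hb, smul_add]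
        zero_mem' := by simp
        smul_mem' := by
          intro h v hv
          simp only [Set.mem_setOf_eq] at hv ⊢
          rw [← hσ, hA, hv, map_smul] }
    obtain ⟨v, hv⟩ := hc.exists_hasEigenvector
    have hU : U ≠ ⊥ := by
      intro hU
      have : v ∈ U := hv.apply_eq_smul
      rw [hU, Submodule.mem_bot] at this
      exact hv.2 this
    have hT : U = ⊤ := (eq_bot_or_eq_top U).resolve_left hU
    intro w
    have : w ∈ U := by rw [hT]; trivial
    exact this
  have hΛ : σ Λ = 0 := by
    by_contra hne
    obtain ⟨v, hv⟩ : ∃ v, σ Λ v ≠ 0 := by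
      by_contra hcon
      push Not at hcon
      exact hne (LinearMap.ext hcon)
    have hw : ∀ h : H, h • (Λ • v) = Coalgebra.counit (R := K) h • (Λ • v) := by
      intro h
      rw [smul_smul, hl, smul_assoc]
    have hact : ∀ (h : H) (c : K), h • c = Coalgebra.counit (R := K) h * c := fun h c => rfl
    let j : K →ₗ[H] V :=
      { toFun := fun c => c • (Λ • v)
        map_add' := by intro a b; exact add_smul a b _
        map_smul' := by
          intro h c
          rw [RingHom.id_apply, hact, mul_comm, mul_smul, ← hw, hcomm] }
    have hj : Function.Injective j := by
      intro a b hab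
      exact smul_left_injective K (show Λ • v ≠ 0 from hv) hab
    have hs : LinearMap.range j = ⊤ := by
      refine (eq_bot_or_eq_top _).resolve_left ?_
      intro hbot
      have : j 1 ∈ LinearMap.range j := ⟨1, rfl⟩
      rw [hbot, Submodule.mem_bot] at this
      exact hv ((one_smul K (Λ • v)).symm.trans this)
    exact hnontrivial.false (LinearEquiv.ofBijective j ⟨hj, LinearMap.range_eq_top.1 hs⟩).symm
  let g := SD.gop e
  have hg4 : g ^ 4 = 1 := SD.gop_sq e σ hb S4 schur
  have hgc := SD.gop_comm e σ hb S4
  have htr := SD.FS_trace e σ hb S4 schur I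
  have t1 := SD.trace_one σ S4 I g hΛ
  have t2 := SD.trace_two σ S4 I g htr
  obtain ⟨s, hs, hsum⟩ := SD.trace_joint (SD.TH σ) (SD.GH g) (SD.TH_GH σ g hgc)
  obtain ⟨t, ht, htsum⟩ := SD.trace_joint (SD.S2 K H) (1 : Module.End K H) (Commute.one_right _)
  have u1 := hsum 1 1
  have u2 := hsum 2 1
  have v1 := htsum 1 0
  have v0 := htsum 0 0
  rw [LinearMap.trace_mul_comm] at u1 u2
  simp only [pow_one] at u1 u2
  rw [t1] at u1
  rw [t2] at u2
  simp only [pow_one, pow_zero, mul_one] at v1 v0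
  rw [SD.trace_S2 S4 I] at v1
  rw [LinearMap.trace_one] at v0
  refine SD.even_of_sums s (t.map Prod.fst) (SD.lam K H 1) _ ?_ ?_ ?_ u1.symm u2.symm v1.symm ?_
  · intro p hp
    exact SD.TH_root σ S4 p.1 (hs p hp).1
  · intro p hp
    exact SD.pow_eigen (hs p hp).2 (by rw [one_smul]; exact SD.GH_four S4 g hg4)
  · intro q hq
    rw [Multiset.mem_map] at hq
    obtain ⟨p, hp, rfl⟩ := hq
    refine SD.pow_eigen (ht p hp).1 ?_
    rw [one_smul]
    ext z
    rw [pow_two]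
    exact S4 z
  · simp only [Multiset.map_const', Multiset.sum_replicate, nsmul_eq_mul, mul_one] at v0
    rw [Multiset.card_map]
    exact_mod_cast v0.symm
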